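/- Let u ≤ w be permutations in Σ_n (Bruhat order) and let α be a composition of ℓ(w)−ℓ(u). Then I_α(u,w) = Σ_{v ∈ Σ_n} c^w_{u,v} · I_α(w₀v, w₀), where I_α(x,y) denotes the number of increasing chains in the labeled Bruhat order from x to y of type α. -/

import Mathlib

open MvPolynomial

noncomputable section

/-- The symmetric group `Σ_n` on `{0, …, n-1}` (0-indexed model of `{1, …, n}`). -/
abbrev Perm' (n : ℕ) := Equiv.Perm (Fin n)

/-- The length `ℓ(w)`: the number of inversions of `w`. -/
def invLength {n : ℕ} (w : Perm' n) : ℕ :=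
  (Finset.univ.filter (fun p : Fin n × Fin n => p.1 < p.2 ∧ w p.2 < w p.1)).card

/-- The longest permutation `w₀ = n … 2 1`. -/
def w0 (n : ℕ) : Perm' n := Fin.revPerm

/-- `u ⋖ w` in the Bruhat order: `w = u·(k,l)` where `k < l`, `u k < u l`, and no
position strictly between `k` and `l` has a `u`-value between `u k` and `u l`. -/
def BruhatCover {n : ℕ} (u w : Perm' n) : Prop :=
  ∃ k l : Fin n, k < l ∧ u k < u l ∧
    (∀ i : Fin n, k < i → i < l → ¬(u k < u i ∧ u i < u l)) ∧
    w = u * Equiv.swap k l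

/-- The Bruhat order, generated by its covers. -/
def BruhatLE {n : ℕ} : Perm' n → Perm' n → Prop :=
  Relation.ReflTransGen BruhatCover

/-- `u →^{(k,b)} w` is a labeled cover in the labeled Bruhat order (0-indexed):
`u ⋖ w` with `u⁻¹w = (i,j)`, `i ≤ k < j` and `b = u i`. -/
def IsLabeledCover {n : ℕ} (u w : Perm' n) (k b : ℕ) : Prop :=
  ∃ i j : Fin n, i < j ∧ u i < u j ∧
    (∀ m : Fin n, i < m → m < j → ¬(u i < u m ∧ u m < u j)) ∧
    w = u * Equiv.swap i j ∧ (i : ℕ) ≤ k ∧ k < (j : ℕ) ∧ b = (u i : ℕ)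

/-- Strict lexicographic order on labels `(k,b)`. -/
def lexLt (p q : ℕ × ℕ) : Prop := p.1 < q.1 ∨ (p.1 = q.1 ∧ p.2 < q.2)

/-- A saturated labeled chain of length `m` from `u` to `w` in the labeled Bruhat order. -/
structure LabeledChain (n m : ℕ) (u w : Perm' n) where
  c : Fin (m + 1) → Perm' n
  lab : Fin m → ℕ × ℕ
  c_zero : c 0 = u
  c_last : c (Fin.last m) = w
  step : ∀ i : Fin m, IsLabeledCover (c i.castSucc) (c i.succ) (lab i).1 (lab i).2

/-- A chain is increasing if its labels strictly increase in lexicographic order. -/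
def LabeledChain.Increasing {n m : ℕ} {u w : Perm' n} (γ : LabeledChain n m u w) : Prop :=
  ∀ i j : Fin m, i < j → lexLt (γ.lab i) (γ.lab j)

/-- The type of a chain: `α_k` counts labels with first coordinate `k`. -/
def chainType {n m : ℕ} {u w : Perm' n} (γ : LabeledChain n m u w) : Fin n → ℕ :=
  fun k => (Finset.univ.filter (fun i : Fin m => (γ.lab i).1 = (k : ℕ))).card

/-- `I_α(u,w)`: the number of increasing chains from `u` to `w` of type `α`. -/
def incChainCount (n : ℕ) (u w : Perm' n) (α : Fin n → ℕ) : ℕ :=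
  Nat.card ((m : ℕ) × {γ : LabeledChain n m u w // γ.Increasing ∧ chainType γ = α})

/-- The staircase monomial `x^δ = x₁^{n-1} x₂^{n-2} ⋯ x_{n-1}`. -/
def xDelta (n : ℕ) : MvPolynomial (Fin n) ℤ :=
  ∏ i : Fin n, X i ^ (n - 1 - (i : ℕ))

/-- `S` is the family of Schubert polynomials: `S w₀ = x^δ` and
`S w - s_i·(S w) = (x_i - x_{i+1}) · S (w s_i)` whenever `ℓ(w s_i) < ℓ(w)`. -/
def IsSchubertFamily (n : ℕ) (S : Perm' n → MvPolynomial (Fin n) ℤ) : Prop :=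
  S (w0 n) = xDelta n ∧
  ∀ (w : Perm' n) (i : ℕ) (h : i + 1 < n),
    invLength (w * Equiv.swap (⟨i, by omega⟩ : Fin n) ⟨i + 1, h⟩) < invLength w →
    S w - rename (Equiv.swap (⟨i, by omega⟩ : Fin n) ⟨i + 1, h⟩) (S w) =
      (X (⟨i, by omega⟩ : Fin n) - X ⟨i + 1, h⟩) *
        S (w * Equiv.swap (⟨i, by omega⟩ : Fin n) ⟨i + 1, h⟩)

/-- The ideal generated by the elementary symmetric polynomials `e₁, …, e_n`. -/
def symIdeal (n : ℕ) : Ideal (MvPolynomial (Fin n) ℤ) :=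
  Ideal.span ((fun k => esymm (Fin n) ℤ k) '' Set.Icc 1 n)

/-- `g` is the normal form of `f` modulo the ideal of elementary symmetric polynomials :
`f ≡ g` and every monomial of `g` divides `x^δ`.  (For the degree reverse lexicographic
term order with `x₁ < ⋯ < x_n`, the normal form is exactly the unique such `g`.) -/
def IsNormalForm (n : ℕ) (f g : MvPolynomial (Fin n) ℤ) : Prop :=
  f - g ∈ symIdeal n ∧ ∀ d ∈ g.support, ∀ i : Fin n, d i ≤ n - 1 - (i : ℕ)

def finSubEquiv {n N : ℕ} (h : n ≤ N) : Fin n ≃ {i : Fin N // (i : ℕ) < n} where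
  toFun i := ⟨Fin.castLE h i, i.isLt⟩
  invFun j := ⟨(j.1 : ℕ), j.2⟩
  left_inv i := rfl
  right_inv j := rfl

/-- The standard inclusion `Σ_n ⊂ Σ_N`, extending a permutation by fixed points. -/
def permIncl {n N : ℕ} (h : n ≤ N) (u : Perm' n) : Perm' N :=
  u.extendDomain (finSubEquiv h)

/-- `δ` as an exponent vector. -/
def deltaF (n : ℕ) : Fin n →₀ ℕ :=
  Finsupp.equivFunOnFinite.symm fun i => n - 1 - (i : ℕ)

/-- The type of a chain as an exponent vector. -/
def chainTypeF {n m : ℕ} {u w : Perm' n} (γ : LabeledChain n m u w) : Fin n →₀ ℕ :=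
  Finsupp.equivFunOnFinite.symm (chainType γ)

/-- `δ` as an integral exponent vector. -/
def deltaZ (n : ℕ) : Fin n →₀ ℤ :=
  Finsupp.equivFunOnFinite.symm fun i => ((n - 1 - (i : ℕ) : ℕ) : ℤ)

/-- The type of a chain as an integral exponent vector. -/
def chainTypeZ {n m : ℕ} {u w : Perm' n} (γ : LabeledChain n m u w) : Fin n →₀ ℤ :=
  Finsupp.equivFunOnFinite.symm fun k => ((chainType γ k : ℕ) : ℤ)

/-- The inclusion of polynomials into Laurent polynomials. -/
def toLaurent (n : ℕ) : MvPolynomial (Fin n) ℤ →+* AddMonoidAlgebra ℤ (Fin n →₀ ℤ) :=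
  AddMonoidAlgebra.mapDomainRingHom ℤ (Finsupp.mapRange.addMonoidHom (Nat.castAddMonoidHom ℤ))

/-- The complete homogeneous symmetric polynomial `h_a(x₁, …, x_k)` inside
`ℤ[x₁, …, x_n]` (variables are 0-indexed, so the first `k` variables are used). -/
def hpoly (n k a : ℕ) : MvPolynomial (Fin n) ℤ :=
  ∑ s ∈ (Finset.univ.filter (fun i : Fin n => (i : ℕ) < k)).sym a,
    ((s : Multiset (Fin n)).map X).prod

/-- `h_α = h_{α₁}(x₁) h_{α₂}(x₁,x₂) ⋯ h_{α_{n-1}}(x₁, …, x_{n-1})` (0-indexed `α`). -/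
def hAlpha (n : ℕ) (α : Fin n → ℕ) : MvPolynomial (Fin n) ℤ :=
  ∏ i : Fin n, hpoly n ((i : ℕ) + 1) (α i)

/- ## rc-graphs (0-indexed pairs: the paper's pair `(k,b)` is `(k-1, b-1)`) -/

/-- The linear order on rc-graph positions: `(k,b) ≤ (j,a)  ⇔  k < j, or k = j and b ≥ a`. -/
def rcLE (p q : ℕ × ℕ) : Prop := p.1 < q.1 ∨ (p.1 = q.1 ∧ q.2 ≤ p.2)

instance : DecidableRel rcLE := fun p q => by unfold rcLE; exact inferInstance
instance : IsTrans (ℕ × ℕ) rcLE :=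
  ⟨fun a b c h1 h2 => by unfold rcLE at h1 h2 ⊢; omega⟩
instance : IsAntisymm (ℕ × ℕ) rcLE :=
  ⟨fun a b h1 h2 => by unfold rcLE at h1 h2; rw [Prod.ext_iff]; omega⟩
instance : IsTotal (ℕ × ℕ) rcLE := ⟨fun a b => by unfold rcLE; omega⟩

/-- The adjacent transposition `s_{i+1} = (i, i+1)` (0-indexed positions). -/
def adjT (n : ℕ) (i : ℕ) : Perm' n :=
  if h : i + 1 < n then Equiv.swap ⟨i, by omega⟩ ⟨i + 1, h⟩ else 1

/-- The word `d(R)` of a set of positions: list its elements in the order `rcLE` and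
record `k + b` for each pair (0-indexed version of `k + b - 1`). -/
def rcWord (R : Finset (ℕ × ℕ)) : List ℕ :=
  (R.sort rcLE).map (fun p => p.1 + p.2)

/-- The permutation given by a word in the adjacent transpositions. -/
def wordPerm (n : ℕ) (l : List ℕ) : Perm' n :=
  (l.map (adjT n)).prod

/-- The permutation of a set of rc-positions. -/
def rcPerm (n : ℕ) (R : Finset (ℕ × ℕ)) : Perm' n := wordPerm n (rcWord R)

/-- `R` consists of valid rc-positions: (0-indexed) `k + b + 2 ≤ n`. -/
def IsRC (n : ℕ) (R : Finset (ℕ × ℕ)) : Prop := ∀ p ∈ R, p.1 + p.2 + 2 ≤ n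

/-- `R ∈ 𝓡(w)`: `R` is an rc-graph associated to `w`, i.e. `d(R)` is a reduced word for `w`. -/
def AssocRC (n : ℕ) (R : Finset (ℕ × ℕ)) (w : Perm' n) : Prop :=
  IsRC n R ∧ rcPerm n R = w ∧ R.card = invLength w

/-- All valid rc-positions for `Σ_n`. -/
def fullRC (n : ℕ) : Finset (ℕ × ℕ) :=
  (Finset.range n ×ˢ Finset.range n).filter (fun p => p.1 + p.2 + 2 ≤ n)

/-- One greedy step: adjoin the lexicographically smallest valid pair not in `R`. -/
def GreedyStep (n : ℕ) (R R' : Finset (ℕ × ℕ)) : Prop :=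
  ∃ p : ℕ × ℕ, p ∉ R ∧ p.1 + p.2 + 2 ≤ n ∧
    (∀ q : ℕ × ℕ, q.1 + q.2 + 2 ≤ n → q ∉ R → (p.1 < q.1 ∨ (p.1 = q.1 ∧ p.2 ≤ q.2))) ∧
    R' = insert p R

/-- The exponent of `x_i` in `x^R`. -/
def rcType (n : ℕ) (R : Finset (ℕ × ℕ)) : Fin n → ℕ :=
  fun i => (R.filter (fun p => p.1 = (i : ℕ))).card

/-- `γ = γ(R)`: the chain `γ` is produced from `R` by the greedy sequence. -/
def GreedyRel (n : ℕ) {m : ℕ} (w : Perm' n) (R : Finset (ℕ × ℕ))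
    (γ : LabeledChain n m w (w0 n)) : Prop :=
  ∃ Rs : ℕ → Finset (ℕ × ℕ), Rs 0 = R ∧
    (∀ i < m, GreedyStep n (Rs i) (Rs (i + 1))) ∧
    (∀ i : Fin m, γ.lab i ∉ Rs (i : ℕ) ∧ Rs ((i : ℕ) + 1) = insert (γ.lab i) (Rs (i : ℕ))) ∧
    (∀ i : Fin (m + 1), rcPerm n (Rs (i : ℕ)) = γ.c i)

/-- `w·(i,j) ⋖ w` with `i < j`: the transposition `(i,j)` goes down a Bruhat cover. -/
def DownCover {n : ℕ} (w : Perm' n) (i j : Fin n) : Prop :=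
  i < j ∧ w j < w i ∧ ∀ m : Fin n, i < m → m < j → ¬(w j < w m ∧ w m < w i)

section Adjacent

variable {n : ℕ} {p q : Fin n}

theorem swap_lt_swap (hpq : (q : ℕ) = p + 1) {x y : Fin n} (hxy : x < y)
    (h : ¬(x = p ∧ y = q)) : Equiv.swap p q x < Equiv.swap p q y := by
  simp only [Equiv.swap_apply_def]
  split_ifs <;> simp only [Fin.lt_def, Fin.ext_iff] at * <;> omega

theorem swap_lt_iff (hpq : (q : ℕ) = p + 1) {K : ℕ} (hK : (q : ℕ) ≠ K) (x : Fin n) :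
    (Equiv.swap p q x : ℕ) < K ↔ (x : ℕ) < K := by
  simp only [Equiv.swap_apply_def]
  split_ifs <;> simp only [Fin.ext_iff] at * <;> omega

theorem swap_swap_apply (w : Perm' n) (x : Fin n) :
    (w * Equiv.swap p q) (Equiv.swap p q x) = w x := by simp

theorem DownCover.descent {w : Perm' n} {i j : Fin n} (hc : DownCover w i j)
    (hpq : (q : ℕ) = p + 1) (hw : w q < w p) (h : ¬(i = p ∧ j = q)) :
    (w * Equiv.swap i j) q < (w * Equiv.swap i j) p := by
  obtain ⟨hij, hv, hm⟩ := hc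
  have inj : ∀ a b : Fin n, w a = w b → a = b := fun a b => w.injective.eq_iff.1
  have e1 := hm p
  have e2 := hm q
  have i1 := inj q j
  have i2 := inj i p
  simp only [Equiv.Perm.mul_apply, Equiv.swap_apply_def]
  split_ifs <;> subst_vars <;>
    simp only [Fin.lt_def, Fin.ext_iff, and_self, not_true_eq_false] at * <;> omega

theorem downCover_iff_swap (hpq : (q : ℕ) = p + 1) {w : Perm' n} (hw : w q < w p) {i j : Fin n}
    (h : ¬(i = p ∧ j = q)) :
    DownCover w i j ↔
      DownCover (w * Equiv.swap p q) (Equiv.swap p q i) (Equiv.swap p q j) ∧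
        (w * Equiv.swap i j) q < (w * Equiv.swap i j) p := by
  have hpq' : p < q := by rw [Fin.lt_def]; omega
  constructor
  · intro hc
    refine ⟨⟨swap_lt_swap hpq hc.1 h, by simpa using hc.2.1, fun m h1 h2 => ?_⟩,
      hc.descent hpq hw h⟩
    obtain ⟨m, rfl⟩ := (Equiv.swap p q).surjective m
    simp only [swap_swap_apply]
    rcases lt_trichotomy i m with him | rfl | him
    · rcases lt_trichotomy m j with hmj | rfl | hmj
      · exact hc.2.2 m him hmj
      · simp
      · by_cases hx : j = p ∧ m = q
        · obtain ⟨rfl, rfl⟩ := hx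
          exact fun hh => absurd hh.1 hw.not_gt
        · exact absurd h2 (swap_lt_swap hpq hmj hx).not_gt
    · simp
    · by_cases hx : m = p ∧ i = q
      · obtain ⟨rfl, rfl⟩ := hx
        exact fun hh => absurd hh.2 hw.not_gt
      · exact absurd h1 (swap_lt_swap hpq him hx).not_gt
  · rintro ⟨⟨h1, h2, h3⟩, h4⟩
    simp only [swap_swap_apply] at h2
    have hij : i < j := by
      by_contra hji
      have hne : i ≠ j := by rintro rfl; exact lt_irrefl _ h1
      have hji : j < i := lt_of_le_of_ne (not_lt.1 hji) hne.symm
      by_cases hx : j = p ∧ i = q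
      · obtain ⟨rfl, rfl⟩ := hx
        exact absurd h2 hw.not_gt
      · exact absurd h1 (swap_lt_swap hpq hji hx).not_gt
    refine ⟨hij, h2, fun m hm1 hm2 => ?_⟩
    by_cases hx : i = p ∧ m = q
    · obtain ⟨rfl, rfl⟩ := hx
      rw [Equiv.Perm.mul_apply, Equiv.Perm.mul_apply, Equiv.swap_apply_left,
        Equiv.swap_apply_of_ne_of_ne hm1.ne' hm2.ne] at h4
      exact fun hh => absurd hh.1 h4.not_gt
    · by_cases hy : m = p ∧ j = q
      · obtain ⟨rfl, rfl⟩ := hy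
        rw [Equiv.Perm.mul_apply, Equiv.Perm.mul_apply, Equiv.swap_apply_right,
          Equiv.swap_apply_of_ne_of_ne hm1.ne' hm2.ne] at h4
        exact fun hh => absurd hh.2 h4.not_gt
      · have := h3 _ (swap_lt_swap hpq hm1 hx) (swap_lt_swap hpq hm2 hy)
        simpa only [swap_swap_apply] using this

theorem mul_swap_mul_swap_swap (w : Perm' n) (p q i j : Fin n) :
    w * Equiv.swap p q * Equiv.swap (Equiv.swap p q i) (Equiv.swap p q j) =
      w * Equiv.swap i j * Equiv.swap p q := by
  rw [mul_assoc, mul_assoc, Equiv.mul_swap_eq_swap_mul (Equiv.swap p q), Equiv.swap_apply_self,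
    Equiv.swap_apply_self]

theorem mul_swap_mul_swap_self (w : Perm' n) (p q : Fin n) :
    w * Equiv.swap p q * Equiv.swap p q = w := by
  rw [mul_assoc, Equiv.swap_mul_self, mul_one]

theorem lt_of_adjacent_lt (w : Perm' n) {i j : Fin n} (hij : i < j)
    (h : ∀ p q : Fin n, (q : ℕ) = p + 1 → i ≤ p → q ≤ j → w p < w q) : w i < w j := by
  obtain ⟨d, hd⟩ : ∃ d, (j : ℕ) = i + 1 + d := Nat.exists_eq_add_of_le hij
  induction d generalizing j with
  | zero => exact h i j hd le_rfl le_rfl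
  | succ d ih =>
    have hj : (i : ℕ) + 1 + d < n := by omega
    have h1 : w i < w ⟨i + 1 + d, hj⟩ :=
      ih (by rw [Fin.lt_def]; dsimp only; omega)
        (fun p q hpq hp hq => h p q hpq hp (hq.trans (by rw [Fin.le_def]; dsimp only; omega))) rfl
    exact h1.trans (h _ _ (by dsimp only; omega) (by rw [Fin.le_def]; dsimp only; omega) le_rfl)

theorem exists_descent {w : Perm' n} (hw : w ≠ 1) :
    ∃ p q : Fin n, (q : ℕ) = p + 1 ∧ w q < w p := by
  by_contra! hcon
  apply hw
  have hmono : StrictMono w := fun i j hij => lt_of_adjacent_lt w hij fun p q hpq _ _ =>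
    lt_of_le_of_ne (hcon p q hpq) fun he => by
      have := w.injective he
      subst this
      omega
  have := Subsingleton.elim (hmono.orderIsoOfSurjective w w.surjective) (OrderIso.refl (Fin n))
  ext i
  exact congrArg Fin.val (DFunLike.congr_fun this i)

theorem invLength_mul_swap (hpq : (q : ℕ) = p + 1) {w : Perm' n} (hw : w q < w p) :
    invLength (w * Equiv.swap p q) + 1 = invLength w := by
  have hpq' : p < q := by rw [Fin.lt_def]; omega
  unfold invLength
  rw [← Finset.card_erase_add_one (a := (p, q)) (s := Finset.univ.filter
    fun x : Fin n × Fin n => x.1 < x.2 ∧ w x.2 < w x.1) (by simp [hpq', hw])]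
  congr 1
  have hs : ∀ x, Equiv.swap p q (Equiv.swap p q x) = x := Equiv.swap_apply_self p q
  refine Finset.card_bij' (fun x _ => (Equiv.swap p q x.1, Equiv.swap p q x.2))
    (fun x _ => (Equiv.swap p q x.1, Equiv.swap p q x.2)) ?_ ?_ (by simp) (by simp)
  · rintro ⟨i, j⟩ hx
    rw [Finset.mem_filter] at hx
    rw [Finset.mem_erase, Finset.mem_filter]
    simp only [Finset.mem_univ, true_and, Equiv.Perm.mul_apply, ne_eq, Prod.mk.injEq] at hx ⊢
    have hne : ¬(i = p ∧ j = q) := by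
      rintro ⟨rfl, rfl⟩
      simp only [Equiv.swap_apply_left, Equiv.swap_apply_right] at hx
      exact hx.2.not_gt hw
    refine ⟨fun hh => ?_, swap_lt_swap hpq hx.1 hne, hx.2⟩
    have h1 : i = q := by rw [← Equiv.swap_apply_left p q, ← hs i, hh.1]
    have h2 : j = p := by rw [← Equiv.swap_apply_right p q, ← hs j, hh.2]
    rw [h1, h2] at hx
    exact hpq'.not_gt hx.1
  · rintro ⟨i, j⟩ hx
    rw [Finset.mem_erase, Finset.mem_filter] at hx
    rw [Finset.mem_filter]
    simp only [Finset.mem_univ, true_and, Equiv.Perm.mul_apply, ne_eq, Prod.mk.injEq, hs] at hx ⊢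
    exact ⟨swap_lt_swap hpq hx.2.1 hx.1, hx.2.2⟩

end Adjacent

open Classical in
/-- The pairs `(i,j)` with `i < K ≤ j` for which `w·(i,j) ⋖ w` exchanges the value `b = w j`. -/
def downSteps {n : ℕ} (K b : ℕ) (w : Perm' n) : Finset (Fin n × Fin n) :=
  Finset.univ.filter fun x =>
    (x.1 : ℕ) < K ∧ K ≤ (x.2 : ℕ) ∧ DownCover w x.1 x.2 ∧ (w x.2 : ℕ) = b

theorem mem_downSteps {n K b : ℕ} {w : Perm' n} {x : Fin n × Fin n} :
    x ∈ downSteps K b w ↔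
      (x.1 : ℕ) < K ∧ K ≤ (x.2 : ℕ) ∧ DownCover w x.1 x.2 ∧ (w x.2 : ℕ) = b := by
  simp [downSteps]

/-- The sum of `φ u` over chains `u → ⋯ → w` of length `a` whose covers exchange positions
across `K` and whose labels increase and are less than `B`. -/
def pieriSum {n : ℕ} (K : ℕ) (φ : Perm' n → ℤ) : ℕ → ℕ → Perm' n → ℤ
  | 0, 0, w => φ w
  | 0, _ + 1, _ => 0
  | B + 1, 0, w => pieriSum K φ B 0 w
  | B + 1, a + 1, w => pieriSum K φ B (a + 1) w +
      ∑ x ∈ downSteps K B w, pieriSum K φ B a (w * Equiv.swap x.1 x.2)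

section PieriSum

variable {n : ℕ} (K : ℕ) (φ : Perm' n → ℤ)

@[simp] theorem pieriSum_zero (B : ℕ) (w : Perm' n) : pieriSum K φ B 0 w = φ w := by
  induction B with
  | zero => rfl
  | succ B ih => rw [pieriSum, ih]

theorem pieriSum_succ (B a : ℕ) (w : Perm' n) :
    pieriSum K φ (B + 1) (a + 1) w = pieriSum K φ B (a + 1) w +
      ∑ x ∈ downSteps K B w, pieriSum K φ B a (w * Equiv.swap x.1 x.2) := by
  rw [pieriSum]

theorem pieriSum_block_zero (B a : ℕ) (w : Perm' n) : pieriSum 0 φ B (a + 1) w = 0 := by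
  induction B with
  | zero => rfl
  | succ B ih =>
    rw [pieriSum_succ, ih, Finset.sum_eq_zero, add_zero]
    intro x hx
    exact absurd (mem_downSteps.1 hx).1 (Nat.not_lt_zero _)

theorem downSteps_ne {K b : ℕ} {w : Perm' n} {x : Fin n × Fin n} (hx : x ∈ downSteps K b w)
    {p q : Fin n} (hpq : (q : ℕ) = p + 1) (hK : (q : ℕ) ≠ K) : ¬(x.1 = p ∧ x.2 = q) := by
  rintro ⟨h1, h2⟩
  have := mem_downSteps.1 hx
  rw [h1, h2] at this
  omega

variable {K φ}

theorem pieriSum_eq_zero_of_descent {p q : Fin n} (hpq : (q : ℕ) = p + 1) (hK : (q : ℕ) ≠ K)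
    (hφ : ∀ u : Perm' n, u q < u p → φ u = 0) (B a : ℕ) {w : Perm' n} (hw : w q < w p) :
    pieriSum K φ B a w = 0 := by
  induction B generalizing a w with
  | zero =>
    cases a with
    | zero => exact hφ w hw
    | succ a => rfl
  | succ B ih =>
    cases a with
    | zero => rw [pieriSum_zero, hφ w hw]
    | succ a =>
      rw [pieriSum_succ, ih _ hw, Finset.sum_eq_zero, add_zero]
      intro x hx
      exact ih _ ((mem_downSteps.1 hx).2.2.1.descent hpq hw (downSteps_ne hx hpq hK))

theorem pieriSum_mul_swap {ψ : Perm' n → ℤ} {p q : Fin n} (hpq : (q : ℕ) = p + 1)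
    (hK : (q : ℕ) ≠ K) (hψ : ∀ u : Perm' n, u q < u p → ψ u = 0)
    (hφ : ∀ u : Perm' n, u q < u p → φ u = ψ (u * Equiv.swap p q)) (B a : ℕ) {w : Perm' n}
    (hw : w q < w p) : pieriSum K φ B a w = pieriSum K ψ B a (w * Equiv.swap p q) := by
  induction B generalizing a w with
  | zero =>
    cases a with
    | zero => exact hφ w hw
    | succ a => rfl
  | succ B ih =>
    cases a with
    | zero => rw [pieriSum_zero, pieriSum_zero, hφ w hw]
    | succ a =>
      rw [pieriSum_succ, pieriSum_succ, ih _ hw]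
      congr 1
      refine Finset.sum_of_injOn (fun x => (Equiv.swap p q x.1, Equiv.swap p q x.2)) ?_ ?_ ?_ ?_
      · rintro ⟨i, j⟩ _ ⟨i', j'⟩ _ h
        simpa using h
      · rintro ⟨i, j⟩ hx
        have hne := downSteps_ne hx hpq hK
        obtain ⟨h1, h2, h3, h4⟩ := mem_downSteps.1 hx
        refine mem_downSteps.2 ⟨(swap_lt_iff hpq hK _).2 h1, ?_,
          ((downCover_iff_swap hpq hw hne).1 h3).1, by rw [swap_swap_apply]; exact h4⟩
        rw [← not_lt, swap_lt_iff hpq hK, not_lt]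
        exact h2
      · rintro ⟨i', j'⟩ hy hn
        obtain ⟨i, rfl⟩ := (Equiv.swap p q).surjective i'
        obtain ⟨j, rfl⟩ := (Equiv.swap p q).surjective j'
        obtain ⟨h1, h2, h3, h4⟩ := mem_downSteps.1 hy
        rw [swap_lt_iff hpq hK] at h1
        rw [← not_lt, swap_lt_iff hpq hK, not_lt] at h2
        rw [swap_swap_apply] at h4
        have hne : ¬(i = p ∧ j = q) := by
          rintro ⟨rfl, rfl⟩
          omega
        dsimp only
        rw [mul_swap_mul_swap_swap]
        refine pieriSum_eq_zero_of_descent hpq hK hψ _ _ ?_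
        rw [Equiv.Perm.mul_apply _ _ q, Equiv.Perm.mul_apply _ _ p, Equiv.swap_apply_left,
          Equiv.swap_apply_right]
        by_contra hlt
        have hpq' : p ≠ q := by rintro rfl; omega
        have hlt' := lt_of_le_of_ne (not_lt.1 hlt)
          ((w * Equiv.swap i j).injective.ne hpq'.symm)
        exact hn ⟨(i, j), mem_downSteps.2
          ⟨h1, h2, (downCover_iff_swap hpq hw hne).2 ⟨h3, hlt'⟩, h4⟩, rfl⟩
      · rintro ⟨i, j⟩ hx
        dsimp only
        rw [mul_swap_mul_swap_swap]
        exact ih _ ((mem_downSteps.1 hx).2.2.1.descent hpq hw (downSteps_ne hx hpq hK))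

end PieriSum

section Grassmannian

variable {n : ℕ}

open Classical in
/-- The positions `j` right of `κ` holding a value less than both `B` and `w κ`. -/
def pivotTargets (κ : Fin n) (B : ℕ) (w : Perm' n) : Finset (Fin n) :=
  Finset.univ.filter fun j => κ < j ∧ (w j : ℕ) < B ∧ w j < w κ

theorem mem_pivotTargets {κ : Fin n} {B : ℕ} {w : Perm' n} {j : Fin n} :
    j ∈ pivotTargets κ B w ↔ κ < j ∧ (w j : ℕ) < B ∧ w j < w κ := by
  simp [pivotTargets]

/-- `w κ` is the largest value at positions up to `κ`, and the values less than `B` right of `κ`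
increase and exceed no value to their left. -/
structure PivotState (κ : Fin n) (B : ℕ) (w : Perm' n) : Prop where
  max : ∀ i, i < κ → w i < w κ
  mono : ∀ j j', κ < j → j < j' → (w j' : ℕ) < B → w j < w j'

variable {κ : Fin n} {B : ℕ} {w : Perm' n}

theorem PivotState.downCover (h : PivotState κ (B + 1) w) {j : Fin n} (hj : κ < j)
    (hB : (w j : ℕ) < B + 1) (hlt : w j < w κ) : DownCover w κ j :=
  ⟨hj, hlt, fun m h1 h2 h3 => absurd h3.1 (h.mono m j h1 h2 hB).not_gt⟩

theorem PivotState.of_succ (h : PivotState κ (B + 1) w) : PivotState κ B w :=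
  ⟨h.max, fun j j' h1 h2 h3 => h.mono j j' h1 h2 (by omega)⟩

theorem PivotState.step (h : PivotState κ (B + 1) w) {x : Fin n × Fin n}
    (hx : x ∈ downSteps κ B w) : κ < x.2 ∧ x.1 < κ ∧ w x.2 < w x.1 := by
  obtain ⟨h1, h2, h3, h4⟩ := mem_downSteps.1 hx
  refine ⟨lt_of_le_of_ne h2 ?_, h1, h3.2.1⟩
  intro he
  have := h.max x.1 h1
  rw [he] at this
  exact this.not_gt h3.2.1

theorem PivotState.mul_swap (h : PivotState κ (B + 1) w) {x : Fin n × Fin n}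
    (hx : x ∈ downSteps κ B w) : PivotState κ B (w * Equiv.swap x.1 x.2) := by
  obtain ⟨h1, h2, h3⟩ := h.step hx
  obtain ⟨-, -, -, h4⟩ := mem_downSteps.1 hx
  obtain ⟨i, j⟩ := x
  dsimp only at h1 h2 h3 h4 ⊢
  have hκ : (w * Equiv.swap i j) κ = w κ := by
    rw [Equiv.Perm.mul_apply, Equiv.swap_apply_of_ne_of_ne h2.ne' h1.ne]
  refine ⟨fun m hm => ?_, fun a b ha hab hb => ?_⟩
  · rw [hκ, Equiv.Perm.mul_apply]
    by_cases hmi : m = i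
    · rw [hmi, Equiv.swap_apply_left]
      exact h3.trans (h.max i h2)
    · rw [Equiv.swap_apply_of_ne_of_ne hmi (hm.trans h1).ne]
      exact h.max m hm
  · have hbi : b ≠ i := (h2.trans (ha.trans hab)).ne'
    have hai : a ≠ i := (h2.trans ha).ne'
    have hbj : b ≠ j := by
      rintro rfl
      rw [Equiv.Perm.mul_apply, Equiv.swap_apply_right] at hb
      rw [Fin.lt_def] at h3
      omega
    have hwb : (w * Equiv.swap i j) b = w b := by
      rw [Equiv.Perm.mul_apply, Equiv.swap_apply_of_ne_of_ne hbi hbj]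
    rw [hwb] at hb ⊢
    have hab' := h.mono a b ha hab (by omega)
    have haj : a ≠ j := by
      rintro rfl
      rw [Fin.lt_def] at hab'
      omega
    rwa [Equiv.Perm.mul_apply, Equiv.swap_apply_of_ne_of_ne hai haj]

theorem PivotState.pivotTargets_mul_swap (h : PivotState κ (B + 1) w) {x : Fin n × Fin n}
    (hx : x ∈ downSteps κ B w) :
    pivotTargets κ B (w * Equiv.swap x.1 x.2) = pivotTargets κ B w := by
  obtain ⟨h1, h2, h3⟩ := h.step hx
  obtain ⟨-, -, -, h4⟩ := mem_downSteps.1 hx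
  obtain ⟨i, j⟩ := x
  dsimp only at h1 h2 h3 h4 ⊢
  have hκ : (w * Equiv.swap i j) κ = w κ := by
    rw [Equiv.Perm.mul_apply, Equiv.swap_apply_of_ne_of_ne h2.ne' h1.ne]
  ext m
  rw [mem_pivotTargets, mem_pivotTargets, hκ]
  by_cases hmj : m = j
  · rw [Fin.lt_def] at h3
    subst hmj
    rw [Equiv.Perm.mul_apply, Equiv.swap_apply_right]
    constructor <;> rintro ⟨_, _, _⟩ <;> omega
  · by_cases hmi : m = i
    · subst hmi
      exact ⟨fun hh => absurd hh.1 h2.not_gt, fun hh => absurd hh.1 h2.not_gt⟩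
    · rw [Equiv.Perm.mul_apply, Equiv.swap_apply_of_ne_of_ne hmi hmj]

theorem PivotState.disjoint_target (h : PivotState κ (B + 1) w) {x : Fin n × Fin n}
    (hx : x ∈ downSteps κ B w) {j : Fin n} (hj : j ∈ pivotTargets κ B w) :
    x.1 ≠ κ ∧ x.1 ≠ j ∧ x.2 ≠ κ ∧ x.2 ≠ j := by
  obtain ⟨h1, h2, -⟩ := h.step hx
  obtain ⟨-, -, -, h4⟩ := mem_downSteps.1 hx
  obtain ⟨g1, g2, -⟩ := mem_pivotTargets.1 hj
  refine ⟨h2.ne, (h2.trans g1).ne, h1.ne', ?_⟩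
  rintro rfl
  omega

theorem PivotState.downSteps_mul_swap (h : PivotState κ (B + 1) w) {j : Fin n}
    (hj : j ∈ pivotTargets κ B w) :
    downSteps (κ + 1) B (w * Equiv.swap κ j) = downSteps κ B w := by
  obtain ⟨g1, g2, g3⟩ := mem_pivotTargets.1 hj
  ext ⟨a, b⟩
  constructor
  · intro hx
    obtain ⟨h1, h2, h3, h4⟩ := mem_downSteps.1 hx
    dsimp only at h1 h2 h3 h4
    have hbκ : κ < b := h2
    have hbj : b ≠ j := by
      rintro rfl
      have hv := h3.2.1
      rw [Equiv.Perm.mul_apply, Equiv.Perm.mul_apply, Equiv.swap_apply_right] at hv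
      by_cases ha : a = κ
      · rw [ha, Equiv.swap_apply_left] at hv
        exact hv.not_gt g3
      · have ha' : a < κ := lt_of_le_of_ne (Nat.lt_succ_iff.1 h1) ha
        rw [Equiv.swap_apply_of_ne_of_ne ha h3.1.ne] at hv
        exact hv.not_gt (h.max a ha')
    have hb : (w * Equiv.swap κ j) b = w b := by
      rw [Equiv.Perm.mul_apply, Equiv.swap_apply_of_ne_of_ne hbκ.ne' hbj]
    rw [hb] at h4
    have haκ : a ≠ κ := by
      rintro rfl
      have hv := h3.2.1
      rw [hb, Equiv.Perm.mul_apply, Equiv.swap_apply_left, Fin.lt_def] at hv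
      omega
    have haκ' : a < κ := lt_of_le_of_ne (Nat.lt_succ_iff.1 h1) haκ
    have ha : (w * Equiv.swap κ j) a = w a := by
      rw [Equiv.Perm.mul_apply, Equiv.swap_apply_of_ne_of_ne haκ (haκ'.trans g1).ne]
    refine mem_downSteps.2 ⟨haκ', (Nat.le_succ _).trans h2, ⟨h3.1, ?_, fun m m1 m2 => ?_⟩, h4⟩
    · simpa only [ha, hb] using h3.2.1
    · have hm := h3.2.2 m m1 m2
      rw [ha, hb] at hm
      by_cases hmκ : m = κ
      · rw [hmκ]
        exact fun hh => absurd hh.2 (h.max a haκ').not_gt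
      · by_cases hmj : m = j
        · rw [hmj]
          intro hh
          have := Fin.lt_def.1 hh.1
          dsimp only at this
          omega
        · rwa [Equiv.Perm.mul_apply, Equiv.swap_apply_of_ne_of_ne hmκ hmj] at hm
  · intro hx
    obtain ⟨d1, d2, d3, d4⟩ := h.disjoint_target hx hj
    obtain ⟨e1, e2, e3⟩ := h.step hx
    obtain ⟨h1, h2, h3, h4⟩ := mem_downSteps.1 hx
    dsimp only at *
    have ha : (w * Equiv.swap κ j) a = w a := by
      rw [Equiv.Perm.mul_apply, Equiv.swap_apply_of_ne_of_ne d1 d2]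
    have hb : (w * Equiv.swap κ j) b = w b := by
      rw [Equiv.Perm.mul_apply, Equiv.swap_apply_of_ne_of_ne d3 d4]
    refine mem_downSteps.2 ⟨h1.trans (Nat.lt_succ_self _), e1, ⟨h3.1, ?_, fun m m1 m2 => ?_⟩, ?_⟩
    · dsimp only
      rwa [ha, hb]
    · dsimp only
      rw [ha, hb, Equiv.Perm.mul_apply]
      by_cases hmκ : m = κ
      · rw [hmκ, Equiv.swap_apply_left]
        intro hh
        have := Fin.lt_def.1 hh.1
        omega
      · by_cases hmj : m = j
        · rw [hmj, Equiv.swap_apply_right]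
          exact fun hh => absurd hh.2 (h.max a e2).not_gt
        · rw [Equiv.swap_apply_of_ne_of_ne hmκ hmj]
          exact h3.2.2 m m1 m2
    · dsimp only
      rw [hb, h4]

theorem PivotState.downSteps_mul_swap_eq_empty {j : Fin n} (hB : (w j : ℕ) = B) :
    downSteps (κ + 1) B (w * Equiv.swap κ j) = ∅ := by
  rw [Finset.eq_empty_iff_forall_notMem]
  intro x hx
  obtain ⟨h1, h2, h3, h4⟩ := mem_downSteps.1 hx
  have : x.2 = κ := by
    apply (w * Equiv.swap κ j).injective
    rw [Equiv.Perm.mul_apply _ _ κ, Equiv.swap_apply_left]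
    exact Fin.ext (h4.trans hB.symm)
  rw [this] at h2
  omega

theorem PivotState.sum_downSteps_succ (h : PivotState κ (B + 1) w) (F : Fin n × Fin n → ℤ) :
    ∑ x ∈ downSteps (κ + 1) B w, F x = ∑ x ∈ downSteps κ B w, F x +
      ∑ j ∈ (pivotTargets κ (B + 1) w).filter (fun j => (w j : ℕ) = B), F (κ, j) := by
  have hdis : Disjoint (downSteps κ B w)
      (((pivotTargets κ (B + 1) w).filter (fun j => (w j : ℕ) = B)).image fun j => (κ, j)) := by
    rw [Finset.disjoint_left]
    rintro x hx hx'
    obtain ⟨j, -, rfl⟩ := Finset.mem_image.1 hx'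
    exact lt_irrefl _ (mem_downSteps.1 hx).1
  rw [← Finset.sum_image (g := fun j => (κ, j)) (f := F) (by intro a _ b _ hab; simpa using hab),
    ← Finset.sum_union hdis]
  congr 1
  ext ⟨a, b⟩
  simp only [Finset.mem_union, Finset.mem_image, Finset.mem_filter, Prod.mk.injEq]
  constructor
  · intro hx
    obtain ⟨h1, h2, h3, h4⟩ := mem_downSteps.1 hx
    dsimp only at *
    by_cases ha : a = κ
    · subst ha
      exact Or.inr ⟨b, ⟨mem_pivotTargets.2 ⟨h3.1, by omega, h3.2.1⟩, h4⟩, rfl, rfl⟩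
    · exact Or.inl (mem_downSteps.2 ⟨lt_of_le_of_ne (Nat.lt_succ_iff.1 h1)
        (fun he => ha (Fin.ext he)), (Nat.le_succ _).trans h2, h3, h4⟩)
  · rintro (hx | ⟨j, ⟨hj, hB⟩, rfl, rfl⟩)
    · obtain ⟨h1, h2, h3, h4⟩ := mem_downSteps.1 hx
      exact mem_downSteps.2 ⟨h1.trans (Nat.lt_succ_self _), (h.step hx).1, h3, h4⟩
    · obtain ⟨g1, g2, g3⟩ := mem_pivotTargets.1 hj
      exact mem_downSteps.2 ⟨Nat.lt_succ_self _, g1, h.downCover g1 g2 g3, hB⟩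

theorem sum_pivotTargets_succ (F : Fin n → ℤ) :
    ∑ j ∈ pivotTargets κ (B + 1) w, F j = ∑ j ∈ pivotTargets κ B w, F j +
      ∑ j ∈ (pivotTargets κ (B + 1) w).filter (fun j => (w j : ℕ) = B), F j := by
  rw [← Finset.sum_filter_add_sum_filter_not _ (fun j => (w j : ℕ) = B), add_comm]
  congr 2
  ext j
  rw [Finset.mem_filter, mem_pivotTargets, mem_pivotTargets]
  constructor
  · rintro ⟨⟨h1, h2, h3⟩, h4⟩
    exact ⟨h1, by omega, h3⟩
  · rintro ⟨h1, h2, h3⟩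
    exact ⟨⟨h1, by omega, h3⟩, by omega⟩

theorem PivotState.pieriSum_succ_block (φ : Perm' n → ℤ) (a : ℕ) (h : PivotState κ B w) :
    pieriSum (κ + 1) φ B (a + 1) w = pieriSum κ φ B (a + 1) w +
      ∑ j ∈ pivotTargets κ B w, pieriSum (κ + 1) φ B a (w * Equiv.swap κ j) := by
  induction B generalizing a w with
  | zero =>
    rw [Finset.sum_eq_zero]
    · rfl
    · intro j hj
      exact absurd (mem_pivotTargets.1 hj).2.1 (Nat.not_lt_zero _)
  | succ B ih =>
    have hlast : ∀ j ∈ (pivotTargets κ (B + 1) w).filter (fun j => (w j : ℕ) = B),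
        pieriSum (κ + 1) φ (B + 1) a (w * Equiv.swap κ j) =
          pieriSum (κ + 1) φ B a (w * Equiv.swap κ j) := by
      intro j hj
      cases a with
      | zero => rw [pieriSum_zero, pieriSum_zero]
      | succ a =>
        rw [pieriSum_succ, PivotState.downSteps_mul_swap_eq_empty (Finset.mem_filter.1 hj).2,
          Finset.sum_empty, add_zero]
    rw [pieriSum_succ, pieriSum_succ, ih a h.of_succ, h.sum_downSteps_succ,
      sum_pivotTargets_succ, Finset.sum_congr rfl hlast]
    have key : ∑ x ∈ downSteps κ B w, pieriSum (κ + 1) φ B a (w * Equiv.swap x.1 x.2) +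
        ∑ j ∈ pivotTargets κ B w, pieriSum (κ + 1) φ B a (w * Equiv.swap κ j) =
        ∑ x ∈ downSteps κ B w, pieriSum κ φ B a (w * Equiv.swap x.1 x.2) +
        ∑ j ∈ pivotTargets κ B w, pieriSum (κ + 1) φ (B + 1) a (w * Equiv.swap κ j) := by
      cases a with
      | zero => simp only [pieriSum_zero]
      | succ a =>
        rw [Finset.sum_congr rfl fun x hx => ih a (h.mul_swap hx), Finset.sum_add_distrib,
          Finset.sum_congr rfl fun j _ => pieriSum_succ (κ + 1) φ B a (w * Equiv.swap κ j),
          Finset.sum_add_distrib]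
        have hcomm : ∑ x ∈ downSteps κ B w,
            ∑ j ∈ pivotTargets κ B (w * Equiv.swap x.1 x.2),
              pieriSum (κ + 1) φ B a (w * Equiv.swap x.1 x.2 * Equiv.swap κ j) =
            ∑ j ∈ pivotTargets κ B w, ∑ x ∈ downSteps (κ + 1) B (w * Equiv.swap κ j),
              pieriSum (κ + 1) φ B a (w * Equiv.swap κ j * Equiv.swap x.1 x.2) := by
          rw [Finset.sum_congr rfl fun x hx => by rw [h.pivotTargets_mul_swap hx],
            Finset.sum_comm]
          refine Finset.sum_congr rfl fun j hj => ?_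
          rw [h.downSteps_mul_swap hj]
          refine Finset.sum_congr rfl fun x hx => ?_
          obtain ⟨d1, d2, d3, d4⟩ := h.disjoint_target hx hj
          rw [mul_assoc, mul_assoc, Equiv.mul_swap_eq_swap_mul (Equiv.swap x.1 x.2),
            Equiv.swap_apply_of_ne_of_ne d1.symm d3.symm,
            Equiv.swap_apply_of_ne_of_ne d2.symm d4.symm]
        linarith
    linarith

end Grassmannian

section DividedDifference

variable {n : ℕ} {p q : Fin n}

theorem ne_of_adjacent (hpq : (q : ℕ) = p + 1) : p ≠ q := by
  rintro rfl
  omega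

theorem X_sub_X_ne_zero (h : p ≠ q) : (X p - X q : MvPolynomial (Fin n) ℤ) ≠ 0 :=
  sub_ne_zero.2 fun he => h (X_injective he)

@[simp] theorem rename_swap_rename_swap (f : MvPolynomial (Fin n) ℤ) :
    rename (Equiv.swap p q) (rename (Equiv.swap p q) f) = f := by
  rw [rename_rename, ← Equiv.coe_trans, Equiv.swap_swap, Equiv.coe_refl, rename_id_apply]

theorem rename_swap_X_sub_X :
    rename (Equiv.swap p q) (X p - X q : MvPolynomial (Fin n) ℤ) = -(X p - X q) := by
  simp

/-- `g` is the divided difference of `f` along the transposition of `x_p` and `x_q`. -/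
def IsDivDiff (p q : Fin n) (f g : MvPolynomial (Fin n) ℤ) : Prop :=
  f - rename (Equiv.swap p q) f = (X p - X q) * g

theorem exists_isDivDiff_X (p q k : Fin n) : ∃ g, IsDivDiff p q (X k) g := by
  by_cases hp : k = p
  · exact ⟨1, by subst hp; simp [IsDivDiff]⟩
  by_cases hq : k = q
  · exact ⟨-1, by subst hq; simp [IsDivDiff]⟩
  · exact ⟨0, by simp [IsDivDiff, Equiv.swap_apply_of_ne_of_ne hp hq]⟩

theorem IsDivDiff.mul {f f' g g' : MvPolynomial (Fin n) ℤ} (h : IsDivDiff p q f g)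
    (h' : IsDivDiff p q f' g') :
    IsDivDiff p q (f * f') (g * f' + rename (Equiv.swap p q) f * g') := by
  unfold IsDivDiff at *
  rw [map_mul]
  linear_combination f' * h + rename (Equiv.swap p q) f * h'

theorem exists_isDivDiff (p q : Fin n) (f : MvPolynomial (Fin n) ℤ) : ∃ g, IsDivDiff p q f g := by
  induction f using MvPolynomial.induction_on with
  | C a => exact ⟨0, by simp [IsDivDiff]⟩
  | add f f' h h' =>
    obtain ⟨g, hg⟩ := h
    obtain ⟨g', hg'⟩ := h'
    refine ⟨g + g', ?_⟩
    unfold IsDivDiff at *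
    rw [map_add]
    linear_combination hg + hg'
  | mul_X f k h =>
    obtain ⟨g, hg⟩ := h
    obtain ⟨g', hg'⟩ := exists_isDivDiff_X p q k
    exact ⟨_, hg.mul hg'⟩

theorem IsDivDiff.rename_eq {f g : MvPolynomial (Fin n) ℤ} (h : IsDivDiff p q f g) (hne : p ≠ q) :
    rename (Equiv.swap p q) g = g := by
  have h2 := congrArg (rename (Equiv.swap p q)) h
  rw [map_sub, map_mul, rename_swap_rename_swap, rename_swap_X_sub_X] at h2
  apply mul_left_cancel₀ (X_sub_X_ne_zero hne)
  unfold IsDivDiff at h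
  linear_combination h + h2

theorem IsDivDiff.mul_symm {f g h : MvPolynomial (Fin n) ℤ} (hd : IsDivDiff p q f g)
    (hh : rename (Equiv.swap p q) h = h) : IsDivDiff p q (f * h) (g * h) := by
  unfold IsDivDiff at *
  rw [map_mul, hh]
  linear_combination h * hd

/-- The pairing of `f` with the Vandermonde determinant: the coefficient of `x^δ` in the
antisymmetrization of `f`. -/
def altCoeff (n : ℕ) : MvPolynomial (Fin n) ℤ →ₗ[ℤ] ℤ :=
  ∑ σ : Perm' n, (Equiv.Perm.sign σ : ℤ) • lcoeff ℤ (Finsupp.mapDomain σ (deltaF n))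

theorem altCoeff_apply (f : MvPolynomial (Fin n) ℤ) :
    altCoeff n f =
      ∑ σ : Perm' n, (Equiv.Perm.sign σ : ℤ) * coeff (Finsupp.mapDomain σ (deltaF n)) f := by
  simp [altCoeff, LinearMap.sum_apply]

theorem altCoeff_eq_zero {f : MvPolynomial (Fin n) ℤ} (h : p ≠ q)
    (hf : rename (Equiv.swap p q) f = f) : altCoeff n f = 0 := by
  have key : altCoeff n f = -altCoeff n f := by
    rw [altCoeff_apply]
    nth_rewrite 1 [← Equiv.sum_comp (Equiv.mulLeft (Equiv.swap p q))]
    rw [← Finset.sum_neg_distrib]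
    refine Finset.sum_congr rfl fun σ _ => ?_
    rw [Equiv.coe_mulLeft, Equiv.Perm.sign_mul, Equiv.Perm.sign_swap h, Equiv.Perm.coe_mul,
      Finsupp.mapDomain_comp]
    nth_rewrite 1 [← hf]
    rw [coeff_rename_mapDomain _ (Equiv.injective _)]
    push_cast
    ring
  omega

theorem IsDivDiff.rename_sub {f g f' g' : MvPolynomial (Fin n) ℤ} (h : p ≠ q)
    (hg : IsDivDiff p q f g) (hg' : IsDivDiff p q f' g') :
    rename (Equiv.swap p q) (f * g' - g * f') = f * g' - g * f' := by
  rw [map_sub, map_mul, map_mul, hg.rename_eq h, hg'.rename_eq h]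
  apply mul_left_cancel₀ (X_sub_X_ne_zero h)
  unfold IsDivDiff at hg hg'
  linear_combination (f - rename (Equiv.swap p q) f) * hg' - (f' - rename (Equiv.swap p q) f') * hg

theorem altCoeff_mul_comm {f g f' g' : MvPolynomial (Fin n) ℤ} (h : p ≠ q)
    (hg : IsDivDiff p q f g) (hg' : IsDivDiff p q f' g') :
    altCoeff n (f * g') = altCoeff n (g * f') := by
  rw [← sub_eq_zero, ← map_sub]
  exact altCoeff_eq_zero h (hg.rename_sub h hg')

theorem deltaF_apply (i : Fin n) : deltaF n i = n - 1 - (i : ℕ) := rfl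

theorem xDelta_eq_monomial : xDelta n = monomial (deltaF n) 1 := by
  rw [monomial_eq, xDelta, C_1, one_mul, Finsupp.prod_fintype _ _ (by simp)]
  rfl

theorem eq_one_of_deltaF_le {σ : Perm' n} (h : deltaF n ≤ Finsupp.mapDomain σ (deltaF n)) :
    σ = 1 := by
  have key : ∀ i, σ i ≥ i := fun i => by
    have := h (σ i)
    rw [Finsupp.mapDomain_apply σ.injective, deltaF_apply, deltaF_apply] at this
    rw [ge_iff_le, Fin.le_def]
    omega
  by_contra hne
  obtain ⟨i, hi⟩ : ∃ i, σ i ≠ i := by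
    by_contra! hh
    exact hne (Equiv.ext hh)
  have hs : ∑ i, (σ i : ℕ) = ∑ i : Fin n, (i : ℕ) := Equiv.sum_comp σ (fun i => (i : ℕ))
  have hlt : ∑ i : Fin n, (i : ℕ) < ∑ i, (σ i : ℕ) :=
    Finset.sum_lt_sum (fun i _ => Fin.le_def.1 (key i))
      ⟨i, Finset.mem_univ _, Fin.lt_def.1 (lt_of_le_of_ne (key i) (Ne.symm hi))⟩
  exact hlt.ne' hs

theorem altCoeff_mul_xDelta (f : MvPolynomial (Fin n) ℤ) :
    altCoeff n (f * xDelta n) = constantCoeff f := by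
  rw [altCoeff_apply, xDelta_eq_monomial, Finset.sum_eq_single 1]
  · rw [Equiv.Perm.sign_one, Equiv.Perm.coe_one, Finsupp.mapDomain_id, coeff_mul_monomial']
    simp [constantCoeff_eq]
  · intro σ _ hσ
    rw [coeff_mul_monomial', if_neg (fun h => hσ (eq_one_of_deltaF_le h)), mul_zero]
  · simp

end DividedDifference

section Pairing

variable {n : ℕ} {S : Perm' n → MvPolynomial (Fin n) ℤ} {p q : Fin n} {w : Perm' n}

theorem IsSchubertFamily.isDivDiff (hS : IsSchubertFamily n S) (hpq : (q : ℕ) = p + 1)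
    (hw : w q < w p) : IsDivDiff p q (S w) (S (w * Equiv.swap p q)) := by
  obtain ⟨p, hp⟩ := p
  obtain ⟨q, hq⟩ := q
  dsimp only at hpq
  subst hpq
  exact hS.2 w p hq (by have := invLength_mul_swap rfl hw; omega)

/-- The coefficient functional of `S w`, written through the Schubert polynomial of `w₀w`. -/
def schubertPairing (S : Perm' n → MvPolynomial (Fin n) ℤ) (w : Perm' n) :
    MvPolynomial (Fin n) ℤ →ₗ[ℤ] ℤ :=
  altCoeff n ∘ₗ LinearMap.mulRight ℤ (S (w0 n * w))

theorem schubertPairing_apply (f : MvPolynomial (Fin n) ℤ) :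
    schubertPairing S w f = altCoeff n (f * S (w0 n * w)) := rfl

theorem w0_mul_lt_iff (w : Perm' n) (i j : Fin n) : (w0 n * w) i < (w0 n * w) j ↔ w j < w i := by
  rw [Equiv.Perm.mul_apply, Equiv.Perm.mul_apply, w0, Fin.revPerm_apply, Fin.revPerm_apply,
    Fin.rev_lt_rev]

theorem w0_mul_w0 (n : ℕ) : w0 n * w0 n = 1 := by
  ext i
  simp [w0]

section Family

variable (hS : IsSchubertFamily n S)
include hS

theorem schubertPairing_one (f : MvPolynomial (Fin n) ℤ) :
    schubertPairing S 1 f = constantCoeff f := by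
  rw [schubertPairing_apply, mul_one, hS.1, altCoeff_mul_xDelta]

theorem schubertPairing_descent (hpq : (q : ℕ) = p + 1) {f g : MvPolynomial (Fin n) ℤ}
    (hg : IsDivDiff p q f g) (hw : w q < w p) :
    schubertPairing S w f = schubertPairing S (w * Equiv.swap p q) g := by
  rw [schubertPairing_apply, schubertPairing_apply]
  refine altCoeff_mul_comm (ne_of_adjacent hpq) hg ?_
  have := hS.isDivDiff (w := w0 n * (w * Equiv.swap p q)) hpq
    (by rw [w0_mul_lt_iff]; simpa using hw)
  rwa [← mul_assoc, mul_swap_mul_swap_self] at this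

theorem schubertPairing_eq_zero (hpq : (q : ℕ) = p + 1) {f : MvPolynomial (Fin n) ℤ}
    (hf : rename (Equiv.swap p q) f = f) (hw : w q < w p) : schubertPairing S w f = 0 := by
  rw [schubertPairing_descent hS hpq (g := 0) (by simp [IsDivDiff, hf]) hw, map_zero]

end Family

end Pairing

section Monk

variable {n : ℕ}

theorem DownCover.of_adjacent {p q : Fin n} {w : Perm' n} (hpq : (q : ℕ) = p + 1)
    (hw : w q < w p) : DownCover w p q := by
  refine ⟨by rw [Fin.lt_def]; omega, hw, fun m h1 h2 => ?_⟩
  rw [Fin.lt_def] at h1 h2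
  omega

theorem invLength_one (n : ℕ) : invLength (1 : Perm' n) = 0 := by
  rw [invLength, Finset.card_eq_zero, Finset.filter_eq_empty_iff]
  exact fun x _ h => h.1.not_gt h.2

theorem eq_one_of_invLength_eq_zero {w : Perm' n} (h : invLength w = 0) : w = 1 := by
  by_contra hne
  obtain ⟨p, q, hpq, hw⟩ := exists_descent hne
  have := invLength_mul_swap hpq hw
  omega

theorem not_downCover_one (i j : Fin n) : ¬DownCover (1 : Perm' n) i j := fun h =>
  h.1.not_gt h.2.1

open Classical in
/-- The coefficient of the transposition of `k` and `j` in Monk's rule, with sign. -/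
def monkCoeff (w : Perm' n) (k j : Fin n) : ℤ :=
  if DownCover w k j then 1 else if DownCover w j k then -1 else 0

theorem monkCoeff_congr {w w' : Perm' n} {k j k' j' : Fin n}
    (h : DownCover w k j ↔ DownCover w' k' j') (h' : DownCover w j k ↔ DownCover w' j' k') :
    monkCoeff w k j = monkCoeff w' k' j' := by
  unfold monkCoeff
  split_ifs <;> tauto

theorem monkCoeff_eq_zero {w : Perm' n} {k j : Fin n} (h : ¬DownCover w k j)
    (h' : ¬DownCover w j k) : monkCoeff w k j = 0 := by
  simp [monkCoeff, h, h']

theorem monkCoeff_eq_one {w : Perm' n} {k j : Fin n} (h : DownCover w k j) :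
    monkCoeff w k j = 1 := by
  simp [monkCoeff, h]

theorem monkCoeff_eq_neg_one {w : Perm' n} {k j : Fin n} (h : DownCover w j k) :
    monkCoeff w k j = -1 := by
  have : ¬DownCover w k j := fun h' => h.1.not_gt h'.1
  simp [monkCoeff, h, this]

variable {S : Perm' n → MvPolynomial (Fin n) ℤ} (hS : IsSchubertFamily n S)
include hS

theorem schubertPairing_monk_term {p q : Fin n} (hpq : (q : ℕ) = p + 1) {w : Perm' n}
    (hw : w q < w p) {f g : MvPolynomial (Fin n) ℤ} (hg : IsDivDiff p q f g) (k j : Fin n) :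
    monkCoeff w k j * schubertPairing S (w * Equiv.swap k j) f =
      monkCoeff (w * Equiv.swap p q) (Equiv.swap p q k) (Equiv.swap p q j) *
          schubertPairing S (w * Equiv.swap k j * Equiv.swap p q) g +
        ((if k = p ∧ j = q then schubertPairing S (w * Equiv.swap p q) f else 0) -
          (if k = q ∧ j = p then schubertPairing S (w * Equiv.swap p q) f else 0)) := by
  have hne := ne_of_adjacent hpq
  have hpq' : p < q := by rw [Fin.lt_def]; omega
  have hs : ∀ i j, (i = p ∧ j = q) ∨ (i = q ∧ j = p) →
      ¬DownCover (w * Equiv.swap p q) (Equiv.swap p q i) (Equiv.swap p q j) := by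
    rintro i j (⟨rfl, rfl⟩ | ⟨rfl, rfl⟩) h
    · rw [Equiv.swap_apply_left, Equiv.swap_apply_right] at h
      exact h.1.not_gt hpq'
    · have := h.2.1
      rw [swap_swap_apply, swap_swap_apply] at this
      exact this.not_gt hw
  by_cases h1 : k = p ∧ j = q
  · have h2 : ¬(k = q ∧ j = p) := fun h => hne (h1.1.symm.trans h.1)
    rw [if_pos h1, if_neg h2, monkCoeff_eq_zero (hs k j (Or.inl h1)) (hs j k (Or.inr h1.symm)),
      h1.1, h1.2, monkCoeff_eq_one (.of_adjacent hpq hw)]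
    ring
  by_cases h2 : k = q ∧ j = p
  · rw [if_neg h1, if_pos h2, monkCoeff_eq_zero (hs k j (Or.inr h2)) (hs j k (Or.inl h2.symm)),
      h2.1, h2.2, monkCoeff_eq_neg_one (.of_adjacent hpq hw), Equiv.swap_comm q p]
    ring
  have h2' : ¬(j = p ∧ k = q) := fun h => h2 h.symm
  rw [if_neg h1, if_neg h2, sub_zero, add_zero]
  have e1 := downCover_iff_swap hpq hw h1
  have e2 := downCover_iff_swap hpq hw h2'
  rw [Equiv.swap_comm j k] at e2
  by_cases hv : (w * Equiv.swap k j) q < (w * Equiv.swap k j) p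
  · rw [schubertPairing_descent hS hpq hg hv]
    congr 1
    exact monkCoeff_congr (by rw [e1, and_iff_left hv]) (by rw [e2, and_iff_left hv])
  · rw [monkCoeff_eq_zero (fun h => hv (e1.1 h).2) (fun h => hv (e2.1 h).2),
      schubertPairing_eq_zero hS hpq (hg.rename_eq hne), mul_zero, zero_mul]
    have := lt_of_le_of_ne (not_lt.1 hv) ((w * Equiv.swap k j).injective.ne hne)
    rw [Equiv.Perm.mul_apply _ _ q, Equiv.Perm.mul_apply _ _ p]
    simpa only [Equiv.swap_apply_left, Equiv.swap_apply_right]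

theorem schubertPairing_X_mul (w : Perm' n) (k : Fin n) (f : MvPolynomial (Fin n) ℤ) :
    schubertPairing S w (X k * f) =
      ∑ j, monkCoeff w k j * schubertPairing S (w * Equiv.swap k j) f := by
  induction hl : invLength w generalizing w k f with
  | zero =>
    obtain rfl := eq_one_of_invLength_eq_zero hl
    rw [schubertPairing_one hS, map_mul, constantCoeff_X, zero_mul, Finset.sum_eq_zero]
    intro j _
    rw [monkCoeff_eq_zero (not_downCover_one _ _) (not_downCover_one _ _), zero_mul]
  | succ l ih =>
    have hne : w ≠ 1 := by
      rintro rfl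
      rw [invLength_one] at hl
      omega
    obtain ⟨p, q, hpq, hw⟩ := exists_descent hne
    have hlen := invLength_mul_swap hpq hw
    obtain ⟨g, hg⟩ := exists_isDivDiff p q f
    have hX : IsDivDiff p q (X k) (C (if k = p then 1 else if k = q then -1 else 0)) := by
      unfold IsDivDiff
      rw [rename_X, Equiv.swap_apply_def]
      split_ifs with h1 h2
      · rw [h1, C_1, mul_one]
      · rw [h2, C_neg, C_1]
        ring
      · rw [C_0, mul_zero, sub_self]
    rw [schubertPairing_descent hS hpq (hX.mul hg) hw, map_add, rename_X,
      ih _ _ _ (by omega), ← Equiv.sum_comp (Equiv.swap p q)]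
    simp only [mul_swap_mul_swap_swap, schubertPairing_monk_term hS hpq hw hg,
      Finset.sum_add_distrib, Finset.sum_sub_distrib]
    rw [add_comm, C_mul', map_smul, smul_eq_mul]
    congr 1
    have hpq' := ne_of_adjacent hpq
    by_cases h1 : k = p
    · subst h1
      simp [hpq']
    by_cases h2 : k = q
    · subst h2
      simp [hpq'.symm]
    simp [h1, h2]

end Monk

section CompleteHomogeneous

variable {n : ℕ}

/-- The complete homogeneous symmetric polynomial of degree `a` in the first `K` variables,
by its recursion on `K` and `a`. -/
def completeH (n : ℕ) : ℕ → ℕ → MvPolynomial (Fin n) ℤ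
  | 0, 0 => 1
  | 0, _ + 1 => 0
  | _ + 1, 0 => 1
  | K + 1, a + 1 => completeH n K (a + 1) +
      (if h : K < n then X ⟨K, h⟩ else 0) * completeH n (K + 1) a

@[simp] theorem completeH_zero (K : ℕ) : completeH n K 0 = 1 := by
  cases K <;> rw [completeH]

theorem completeH_succ (k : Fin n) (a : ℕ) :
    completeH n (k + 1) (a + 1) = completeH n k (a + 1) + X k * completeH n (k + 1) a := by
  rw [completeH, dif_pos k.isLt]

theorem completeH_succ_of_le {K : ℕ} (hK : n ≤ K) (a : ℕ) :
    completeH n (K + 1) (a + 1) = completeH n K (a + 1) := by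
  rw [completeH, dif_neg (not_lt.2 hK), zero_mul, add_zero]

theorem rename_completeH_of_lt {p q : Fin n} (hpq : (q : ℕ) = p + 1) {K : ℕ} (hK : K < q)
    (a : ℕ) : rename (Equiv.swap p q) (completeH n K a) = completeH n K a := by
  induction K generalizing a with
  | zero =>
    cases a with
    | zero => simp
    | succ a => simp [completeH]
  | succ K ih =>
    induction a with
    | zero => simp
    | succ a iha =>
      have hs := completeH_succ ⟨K, (Nat.lt_of_succ_lt hK).trans q.isLt⟩ a
      dsimp only at hs
      rw [hs, map_add, map_mul, ih (by omega), iha, rename_X, Equiv.swap_apply_of_ne_of_ne]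
      · rw [ne_eq, Fin.ext_iff]; dsimp only; omega
      · rw [ne_eq, Fin.ext_iff]; dsimp only; omega

theorem completeH_one (k : Fin n) : completeH n (k + 1) 1 = completeH n k 1 + X k := by
  rw [completeH_succ, completeH_zero, mul_one]

theorem completeH_two_step {p q : Fin n} (hpq : (q : ℕ) = p + 1) (a : ℕ) :
    completeH n (q + 1) (a + 2) = completeH n p (a + 2) +
      (X p + X q) * completeH n (q + 1) (a + 1) - X p * X q * completeH n (q + 1) a := by
  have h1 := completeH_succ q (a + 1)
  have h2 := completeH_succ p (a + 1)
  have h3 := completeH_succ q a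
  rw [← hpq] at h2
  linear_combination h1 + h2 - X p * h3

theorem rename_completeH_block {p q : Fin n} (hpq : (q : ℕ) = p + 1) (a : ℕ) :
    rename (Equiv.swap p q) (completeH n (q + 1) a) = completeH n (q + 1) a := by
  have hp : (p : ℕ) < q := by omega
  induction a using Nat.twoStepInduction with
  | zero => simp
  | one =>
    have h := completeH_one p
    rw [← hpq] at h
    rw [completeH_one, h, map_add, map_add, rename_completeH_of_lt hpq hp, rename_X, rename_X,
      Equiv.swap_apply_left, Equiv.swap_apply_right]
    ring
  | more a h1 h2 =>
    rw [completeH_two_step hpq, map_sub, map_add, map_mul, map_mul, map_mul, map_add, h1, h2,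
      rename_completeH_of_lt hpq hp, rename_X, rename_X, Equiv.swap_apply_left,
      Equiv.swap_apply_right]
    ring

theorem rename_completeH {p q : Fin n} (hpq : (q : ℕ) = p + 1) {K : ℕ} (hK : (q : ℕ) ≠ K)
    (a : ℕ) : rename (Equiv.swap p q) (completeH n K a) = completeH n K a := by
  rcases lt_or_gt_of_ne hK with h | h
  · obtain ⟨d, rfl⟩ := Nat.exists_eq_add_of_le (Nat.succ_le_of_lt h)
    clear h hK
    induction d generalizing a with
    | zero => exact rename_completeH_block hpq a
    | succ d ih =>
      induction a with
      | zero => simp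
      | succ a iha =>
        rw [← add_assoc] at iha ⊢
        by_cases hlt : (q : ℕ).succ + d < n
        · have hs := completeH_succ ⟨(q : ℕ).succ + d, hlt⟩ a
          dsimp only at hs
          rw [hs, map_add, map_mul, ih, iha, rename_X, Equiv.swap_apply_of_ne_of_ne]
          · rw [ne_eq, Fin.ext_iff]; dsimp only; omega
          · rw [ne_eq, Fin.ext_iff]; dsimp only; omega
        · rw [completeH_succ_of_le (not_lt.1 hlt), ih]
  · exact rename_completeH_of_lt hpq h a

end CompleteHomogeneous

section Pieri

variable {n : ℕ} {S : Perm' n → MvPolynomial (Fin n) ℤ} (hS : IsSchubertFamily n S)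

/-- The sum of `φ` over the chains ending at `w` whose `k`-th block, of length `α k`, exchanges
positions across `k + 1`, for `k < K`. -/
def blockSum {n : ℕ} (α : ℕ → ℕ) (φ : Perm' n → ℤ) : ℕ → Perm' n → ℤ
  | 0 => φ
  | K + 1 => pieriSum (K + 1) (blockSum α φ K) n (α K)

theorem pivotState_of_no_descent {κ : Fin n} {w : Perm' n}
    (h : ∀ p q : Fin n, (q : ℕ) = p + 1 → (q : ℕ) ≠ κ + 1 → w p < w q) : PivotState κ n w := by
  refine ⟨fun i hi => lt_of_adjacent_lt w hi fun p q hpq _ hq => h p q hpq ?_,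
    fun i j hi hij _ => lt_of_adjacent_lt w hij fun p q hpq hp _ => h p q hpq ?_⟩
  · rw [Fin.le_def] at hq
    omega
  · rw [Fin.le_def] at hp
    rw [Fin.lt_def] at hi
    omega

theorem PivotState.sum_monkCoeff {κ : Fin n} {w : Perm' n} (h : PivotState κ n w)
    (F : Fin n → ℤ) : ∑ j, monkCoeff w κ j * F j = ∑ j ∈ pivotTargets κ n w, F j := by
  symm
  rw [← Finset.sum_subset (Finset.subset_univ (pivotTargets κ n w))]
  · refine Finset.sum_congr rfl fun j hj => ?_
    obtain ⟨h1, -, h2⟩ := mem_pivotTargets.1 hj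
    rw [monkCoeff_eq_one ⟨h1, h2, fun m m1 m2 m3 =>
      absurd m3.1 (h.mono m j m1 m2 (w j).isLt).not_gt⟩, one_mul]
  · intro j _ hj
    rw [monkCoeff_eq_zero, zero_mul]
    · exact fun hd => hj (mem_pivotTargets.2 ⟨hd.1, (w j).isLt, hd.2.1⟩)
    · exact fun hd => (h.max j hd.1).not_gt hd.2.1

include hS

theorem pieriSum_schubertPairing {K : ℕ} (hK : K ≤ n) (f : MvPolynomial (Fin n) ℤ) (a : ℕ)
    (w : Perm' n) : pieriSum K (fun u => schubertPairing S u f) n a w =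
      schubertPairing S w (f * completeH n K a) := by
  induction K generalizing f a w with
  | zero =>
    cases a with
    | zero => rw [pieriSum_zero, completeH_zero, mul_one]
    | succ a => rw [pieriSum_block_zero, completeH, mul_zero, map_zero]
  | succ K ih =>
    induction a generalizing f w with
    | zero => rw [pieriSum_zero, completeH_zero, mul_one]
    | succ a iha =>
      induction hl : invLength w using Nat.strong_induction_on generalizing w f with
      | _ l ihl =>
      by_cases hd : ∃ p q : Fin n, (q : ℕ) = p + 1 ∧ (q : ℕ) ≠ K + 1 ∧ w q < w p
      · obtain ⟨p, q, hpq, hqK, hw⟩ := hd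
        obtain ⟨g, hg⟩ := exists_isDivDiff p q f
        have hlen := invLength_mul_swap hpq hw
        rw [pieriSum_mul_swap hpq hqK (ψ := fun u => schubertPairing S u g)
          (fun u => schubertPairing_eq_zero hS hpq (hg.rename_eq (ne_of_adjacent hpq)))
          (fun u => schubertPairing_descent hS hpq hg) _ _ hw, ihl _ (by omega) _ _ rfl,
          schubertPairing_descent hS hpq (hg.mul_symm (rename_completeH hpq hqK _)) hw]
      · have hp : PivotState ⟨K, hK⟩ n w := pivotState_of_no_descent fun p q hpq hqK =>
          lt_of_le_of_ne (not_lt.1 fun h => hd ⟨p, q, hpq, hqK, h⟩)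
            (w.injective.ne (ne_of_adjacent hpq))
        have h1 := hp.pieriSum_succ_block (fun u => schubertPairing S u f) a
        have h2 := completeH_succ ⟨K, hK⟩ a
        dsimp only at h1 h2
        rw [h1, h2, ih (by omega), mul_add, map_add, Finset.sum_congr rfl fun j _ => iha f _,
          mul_left_comm, schubertPairing_X_mul hS, hp.sum_monkCoeff]

theorem blockSum_schubertPairing (α : ℕ → ℕ) {K : ℕ} (hK : K ≤ n) (f : MvPolynomial (Fin n) ℤ)
    (w : Perm' n) : blockSum α (fun u => schubertPairing S u f) K w =
      schubertPairing S w (f * ∏ k ∈ Finset.range K, completeH n (k + 1) (α k)) := by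
  induction K generalizing w with
  | zero => rw [blockSum, Finset.range_zero, Finset.prod_empty, mul_one]
  | succ K ih =>
    rw [blockSum, funext fun w => ih (by omega) w, pieriSum_schubertPairing hS hK,
      Finset.prod_range_succ, mul_assoc]

end Pieri

section Code

variable {n : ℕ} {p q : Fin n} {w : Perm' n}

/-- The Lehmer code of `w` at `i`. -/
def lehmerCode (w : Perm' n) (i : Fin n) : ℕ :=
  (Finset.univ.filter fun j => i < j ∧ w j < w i).card

theorem invLength_eq_sum_lehmerCode (w : Perm' n) : invLength w = ∑ i, lehmerCode w i := by
  simp only [invLength, lehmerCode, Finset.card_filter, ← Finset.univ_product_univ,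
    Finset.sum_product]

theorem lehmerCode_w0 (i : Fin n) : lehmerCode (w0 n) i = n - 1 - i := by
  rw [← Fin.card_Ioi, lehmerCode]
  congr 1
  ext j
  simp [w0]

theorem lehmerCode_one (i : Fin n) : lehmerCode (1 : Perm' n) i = 0 := by
  rw [lehmerCode, Finset.card_eq_zero, Finset.filter_eq_empty_iff]
  exact fun x _ h => h.1.not_gt h.2

theorem lehmerCode_lt (hpq : (q : ℕ) = p + 1) (hw : w q < w p) :
    lehmerCode w q < lehmerCode w p := by
  have hpq' : p < q := by rw [Fin.lt_def]; omega
  refine Finset.card_lt_card ((Finset.ssubset_iff_of_subset fun j hj => ?_).2 ⟨q, ?_, ?_⟩)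
  · rw [Finset.mem_filter] at hj ⊢
    exact ⟨hj.1, hpq'.trans hj.2.1, hj.2.2.trans hw⟩
  · rw [Finset.mem_filter]
    exact ⟨Finset.mem_univ _, hpq', hw⟩
  · rw [Finset.mem_filter]
    exact fun h => lt_irrefl _ h.2.1

theorem lehmerCode_le (hpq : (q : ℕ) = p + 1) (hw : w p < w q) :
    lehmerCode w p ≤ lehmerCode w q := by
  refine Finset.card_le_card fun j hj => ?_
  rw [Finset.mem_filter] at hj ⊢
  refine ⟨hj.1, lt_of_le_of_ne ?_ ?_, hj.2.2.trans hw⟩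
  · have := Fin.lt_def.1 hj.2.1
    rw [Fin.le_def]
    omega
  · rintro rfl
    exact hw.not_gt hj.2.2

theorem lehmerCode_mul_swap (hpq : (q : ℕ) = p + 1) (hw : w p < w q)
    (he : lehmerCode w q = lehmerCode w p) (i : Fin n) :
    lehmerCode (w * Equiv.swap p q) i = lehmerCode w i + if i = p then 1 else 0 := by
  have hpq' : p < q := by rw [Fin.lt_def]; omega
  by_cases hip : i = p
  · subst hip
    rw [if_pos rfl, ← he, lehmerCode, lehmerCode, ← Finset.card_insert_of_notMem (a := q)
      (by rw [Finset.mem_filter]; exact fun h => lt_irrefl _ h.2.1)]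
    congr 1
    ext j
    rw [Finset.mem_insert, Finset.mem_filter, Finset.mem_filter, Equiv.Perm.mul_apply,
      Equiv.Perm.mul_apply, Equiv.swap_apply_left]
    by_cases hj : j = q
    · subst hj
      simp [hw, hpq']
    · by_cases hji : j = i
      · subst hji
        simp [hpq'.not_gt, hj]
      · rw [Equiv.swap_apply_of_ne_of_ne hji hj]
        simp only [hj, false_or, Finset.mem_univ, true_and]
        rw [Fin.ext_iff] at hj
        simp only [Fin.lt_def]
        omega
  rw [if_neg hip, add_zero]
  by_cases hiq : i = q
  · subst hiq
    rw [he, lehmerCode, lehmerCode]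
    congr 1
    ext j
    rw [Finset.mem_filter, Finset.mem_filter, Equiv.Perm.mul_apply,
      Equiv.Perm.mul_apply, Equiv.swap_apply_right]
    by_cases hj : j = i
    · subst hj
      simp [hw.not_gt]
    · by_cases hji : j = p
      · subst hji
        simp [hpq'.not_gt]
      · rw [Equiv.swap_apply_of_ne_of_ne hji hj]
        simp only [Finset.mem_univ, true_and]
        rw [Fin.ext_iff] at hj hji
        simp only [Fin.lt_def]
        omega
  · have hs : ∀ j, i < Equiv.swap p q j ↔ i < j := by
      intro j
      rw [Equiv.swap_apply_def]
      rw [Fin.ext_iff] at hip hiq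
      split_ifs with h1 h2
      · rw [h1, Fin.lt_def, Fin.lt_def]; omega
      · rw [h2, Fin.lt_def, Fin.lt_def]; omega
      · rfl
    refine Finset.card_equiv (Equiv.swap p q) fun j => ?_
    rw [Finset.mem_filter, Finset.mem_filter, hs, Equiv.Perm.mul_apply, Equiv.Perm.mul_apply,
      Equiv.swap_apply_of_ne_of_ne hip hiq]
    simp

end Code

section SchubertBasics

variable {n : ℕ} {S : Perm' n → MvPolynomial (Fin n) ℤ} {p q : Fin n}

theorem homogeneousComponent_X_mul (p : Fin n) (d : ℕ) (g : MvPolynomial (Fin n) ℤ) :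
    homogeneousComponent (d + 1) (X p * g) = X p * homogeneousComponent d g := by
  ext m
  rw [coeff_homogeneousComponent, coeff_X_mul', coeff_X_mul', coeff_homogeneousComponent]
  by_cases hp : p ∈ m.support
  · have hm : m - Finsupp.single p 1 + Finsupp.single p 1 = m :=
      tsub_add_cancel_of_le (Finsupp.single_le_iff.2
        (Nat.one_le_iff_ne_zero.2 (Finsupp.mem_support_iff.1 hp)))
    have hd : m.degree = (m - Finsupp.single p 1).degree + 1 := by
      conv_lhs => rw [← hm]
      rw [map_add, Finsupp.degree_single]
    simp only [if_pos hp, hd, Nat.add_right_cancel_iff]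
  · simp [hp]

theorem isHomogeneous_of_sub_mul (h : p ≠ q) {d : ℕ} {g : MvPolynomial (Fin n) ℤ}
    (hg : ((X p - X q) * g).IsHomogeneous (d + 1)) : g.IsHomogeneous d := by
  have key : ∀ e, e ≠ d → homogeneousComponent e g = 0 := by
    intro e he
    apply mul_left_cancel₀ (X_sub_X_ne_zero h)
    rw [mul_zero, sub_mul, ← homogeneousComponent_X_mul, ← homogeneousComponent_X_mul, ← map_sub,
      ← sub_mul, homogeneousComponent_of_mem hg, if_neg (by omega)]
  intro m hm
  by_contra hne
  have := congrArg (coeff m) (key m.degree (by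
    rw [Finsupp.degree_eq_weight_one]
    exact hne))
  rw [coeff_homogeneousComponent, if_pos rfl] at this
  exact hm this

theorem eq_w0_of_invLength {w : Perm' n} (h : invLength (w0 n * w) = 0) : w = w0 n := by
  rw [← one_mul w, ← w0_mul_w0, mul_assoc, eq_one_of_invLength_eq_zero h, mul_one]

theorem exists_ascent {w : Perm' n} (h : w ≠ w0 n) :
    ∃ p q : Fin n, (q : ℕ) = p + 1 ∧ w p < w q := by
  have h1 : w0 n * w ≠ 1 := fun he => h (eq_w0_of_invLength (by rw [he, invLength_one]))
  obtain ⟨p, q, hpq, hw⟩ := exists_descent h1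
  exact ⟨p, q, hpq, (w0_mul_lt_iff w q p).1 hw⟩

theorem invLength_w0_mul_swap (hpq : (q : ℕ) = p + 1) {w : Perm' n} (hw : w p < w q) :
    invLength (w0 n * (w * Equiv.swap p q)) + 1 = invLength (w0 n * w) := by
  rw [← mul_assoc]
  exact invLength_mul_swap hpq ((w0_mul_lt_iff w q p).2 hw)

/-- Induction from `w₀` downwards along an ascent of each `w ≠ w₀`. -/
theorem ascent_induction {P : Perm' n → Prop} (base : P (w0 n))
    (step : ∀ w, w ≠ w0 n →
      (∀ p q : Fin n, (q : ℕ) = p + 1 → w p < w q → P (w * Equiv.swap p q)) → P w)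
    (w : Perm' n) : P w := by
  induction hl : invLength (w0 n * w) using Nat.strong_induction_on generalizing w with
  | _ l ih =>
    by_cases h : w = w0 n
    · rwa [h]
    · refine step w h fun p q hpq hw => ih _ ?_ _ rfl
      have := invLength_w0_mul_swap hpq hw
      omega

/-- Induction from the identity upwards along a descent of each `w ≠ 1`. -/
theorem descent_induction {P : Perm' n → Prop} (base : P 1)
    (step : ∀ (w : Perm' n) (p q : Fin n), (q : ℕ) = p + 1 → w q < w p →
      P (w * Equiv.swap p q) → P w)
    (w : Perm' n) : P w := by
  induction hl : invLength w using Nat.strong_induction_on generalizing w with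
  | _ l ih =>
    by_cases h : w = 1
    · rwa [h]
    · obtain ⟨p, q, hpq, hw⟩ := exists_descent h
      have := invLength_mul_swap hpq hw
      exact step w p q hpq hw (ih _ (by omega) _ rfl)

variable (hS : IsSchubertFamily n S)
include hS

theorem IsSchubertFamily.isDivDiff_mul_swap (hpq : (q : ℕ) = p + 1) {w : Perm' n}
    (hw : w p < w q) : IsDivDiff p q (S (w * Equiv.swap p q)) (S w) := by
  have := hS.isDivDiff (w := w * Equiv.swap p q) hpq (by simpa using hw)
  rwa [mul_swap_mul_swap_self] at this

theorem IsSchubertFamily.rename_eq (hpq : (q : ℕ) = p + 1) {w : Perm' n}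
    (hw : w p < w q) : rename (Equiv.swap p q) (S w) = S w :=
  (hS.isDivDiff_mul_swap hpq hw).rename_eq (ne_of_adjacent hpq)

theorem IsSchubertFamily.isHomogeneous (w : Perm' n) : (S w).IsHomogeneous (invLength w) := by
  induction w using ascent_induction with
  | base =>
    rw [hS.1, xDelta, invLength_eq_sum_lehmerCode]
    refine IsHomogeneous.prod _ _ _ fun i _ => ?_
    rw [lehmerCode_w0]
    exact isHomogeneous_X_pow i _
  | step w hw ih =>
    obtain ⟨p, q, hpq, hpw⟩ := exists_ascent hw
    have h1 := ih p q hpq hpw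
    have h2 := invLength_mul_swap (w := w * Equiv.swap p q) hpq (by simpa using hpw)
    rw [mul_swap_mul_swap_self] at h2
    rw [← h2] at h1
    refine isHomogeneous_of_sub_mul (ne_of_adjacent hpq) ?_
    rw [← hS.isDivDiff_mul_swap hpq hpw]
    exact h1.sub h1.rename_isHomogeneous

theorem IsSchubertFamily.eq_monomial_of_dominant (w : Perm' n)
    (hw : ∀ p q : Fin n, (q : ℕ) = p + 1 → lehmerCode w q ≤ lehmerCode w p) :
    S w = monomial (Finsupp.equivFunOnFinite.symm (lehmerCode w)) 1 := by
  induction w using ascent_induction with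
  | base =>
    rw [hS.1, xDelta_eq_monomial]
    congr 2
    ext i
    simp [lehmerCode_w0, deltaF_apply]
  | step w hne ih =>
    obtain ⟨p₀, q₀, h₀⟩ := exists_ascent hne
    obtain ⟨p, ⟨q, hpq, hpw⟩, hmin⟩ := WellFounded.has_min (wellFounded_lt (α := Fin n))
      {p | ∃ q : Fin n, (q : ℕ) = p + 1 ∧ w p < w q} ⟨p₀, q₀, h₀⟩
    have hne' := ne_of_adjacent hpq
    have he : lehmerCode w q = lehmerCode w p := le_antisymm (hw p q hpq) (lehmerCode_le hpq hpw)
    have hcode := lehmerCode_mul_swap hpq hpw he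
    have hv := ih p q hpq hpw (by
      intro p' q' hpq'
      rw [hcode, hcode]
      have := hw p' q' hpq'
      by_cases hq' : q' = p
      · subst hq'
        have hlt : w q' < w p' := by
          refine lt_of_le_of_ne (not_lt.1 fun h => ?_) (w.injective.ne (ne_of_adjacent hpq').symm)
          exact hmin p' ⟨q', hpq', h⟩ (by rw [Fin.lt_def]; omega)
        have := lehmerCode_lt hpq' hlt
        rw [if_pos rfl]
        omega
      · rw [if_neg hq']
        omega)
    have hmon : S (w * Equiv.swap p q) =
        X p * monomial (Finsupp.equivFunOnFinite.symm (lehmerCode w)) 1 := by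
      rw [hv, X, monomial_mul, one_mul]
      congr 2
      ext i
      rw [Finsupp.equivFunOnFinite_symm_apply_apply, hcode, Finsupp.add_apply,
        Finsupp.single_apply, add_comm, Finsupp.equivFunOnFinite_symm_apply_apply]
      simp only [eq_comm]
    have hinv : rename (Equiv.swap p q)
        (monomial (Finsupp.equivFunOnFinite.symm (lehmerCode w)) (1 : ℤ)) =
          monomial (Finsupp.equivFunOnFinite.symm (lehmerCode w)) 1 := by
      rw [rename_monomial]
      congr 2
      ext i
      obtain ⟨i, rfl⟩ := (Equiv.swap p q).surjective i
      rw [Finsupp.mapDomain_apply (Equiv.injective _), Finsupp.equivFunOnFinite_symm_apply_apply,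
        Finsupp.equivFunOnFinite_symm_apply_apply, Equiv.swap_apply_def]
      split_ifs with h1 h2
      · rw [h1, he]
      · rw [h2, he]
      · rfl
    have hd := hS.isDivDiff_mul_swap hpq hpw
    apply mul_left_cancel₀ (X_sub_X_ne_zero hne')
    rw [← hd, hmon, map_mul, hinv, rename_X, Equiv.swap_apply_left]
    ring

theorem IsSchubertFamily.one : S 1 = 1 := by
  rw [hS.eq_monomial_of_dominant 1 fun p q _ => by rw [lehmerCode_one, lehmerCode_one],
    ← C_1, C_apply]
  congr 2
  ext i
  simp [lehmerCode_one]

open Classical in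
theorem schubertPairing_self (w u : Perm' n) :
    schubertPairing S w (S u) = if u = w then 1 else 0 := by
  induction w using descent_induction generalizing u with
  | base =>
    rw [schubertPairing_one hS]
    split_ifs with h
    · rw [h, hS.one, map_one]
    · refine (hS.isHomogeneous u).coeff_eq_zero ?_
      rw [map_zero]
      exact fun he => h (eq_one_of_invLength_eq_zero he.symm)
  | step w p q hpq hw ih =>
    rcases lt_or_gt_of_ne (u.injective.ne (ne_of_adjacent hpq)) with hu | hu
    · rw [schubertPairing_eq_zero hS hpq (hS.rename_eq hpq hu) hw, if_neg]
      rintro rfl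
      exact hw.not_gt hu
    · rw [schubertPairing_descent hS hpq (hS.isDivDiff hpq hu) hw, ih]
      simp only [mul_left_inj]

theorem schubertPairing_eq_zero_of_isHomogeneous {w : Perm' n} {d : ℕ} (hd : d ≠ invLength w)
    {f : MvPolynomial (Fin n) ℤ} (hf : f.IsHomogeneous d) : schubertPairing S w f = 0 := by
  induction w using descent_induction generalizing f d with
  | base =>
    rw [schubertPairing_one hS]
    refine hf.coeff_eq_zero ?_
    rw [map_zero]
    rw [invLength_one] at hd
    exact hd.symm
  | step w p q hpq hw ih =>
    obtain ⟨g, hg⟩ := exists_isDivDiff p q f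
    have hl := invLength_mul_swap hpq hw
    cases d with
    | zero =>
      refine schubertPairing_eq_zero hS hpq ?_ hw
      rw [totalDegree_eq_zero_iff_eq_C.1 ((totalDegree_zero_iff_isHomogeneous _).2 hf), rename_C]
    | succ d =>
      rw [schubertPairing_descent hS hpq hg hw]
      refine ih (d := d) (by omega) (isHomogeneous_of_sub_mul (ne_of_adjacent hpq) ?_)
      rw [← hg]
      exact hf.sub hf.rename_isHomogeneous

theorem schubertPairing_self_mul (w : Perm' n) (f : MvPolynomial (Fin n) ℤ) :
    schubertPairing S w (S w * f) = constantCoeff f := by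
  conv_lhs => rw [← sum_homogeneousComponent f]
  rw [Finset.mul_sum, map_sum, Finset.sum_range_succ', Finset.sum_eq_zero, zero_add,
    homogeneousComponent_zero, mul_comm, C_mul', map_smul, schubertPairing_self hS, if_pos rfl,
    smul_eq_mul, mul_one, constantCoeff_eq]
  intro d _
  exact schubertPairing_eq_zero_of_isHomogeneous hS (by omega)
    ((hS.isHomogeneous w).mul (homogeneousComponent_isHomogeneous (d + 1) f))

end SchubertBasics

section Inclusion

variable {n N : ℕ} (hnN : n ≤ N)

theorem permIncl_castLE (u : Perm' n) (i : Fin n) :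
    permIncl hnN u (Fin.castLE hnN i) = Fin.castLE hnN (u i) :=
  Equiv.Perm.extendDomain_apply_image u (finSubEquiv hnN) i

theorem permIncl_of_le (u : Perm' n) {j : Fin N} (hj : n ≤ (j : ℕ)) : permIncl hnN u j = j :=
  Equiv.Perm.extendDomain_apply_not_subtype u (finSubEquiv hnN) (not_lt.2 hj)

theorem permIncl_mul (u v : Perm' n) : permIncl hnN (u * v) = permIncl hnN u * permIncl hnN v :=
  (Equiv.Perm.extendDomain_mul (finSubEquiv hnN) u v).symm

theorem permIncl_one : permIncl hnN 1 = 1 := Equiv.Perm.extendDomain_one (finSubEquiv hnN)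

theorem permIncl_injective : Function.Injective (permIncl hnN) := fun u v h => by
  ext i
  have := DFunLike.congr_fun h (Fin.castLE hnN i)
  rw [permIncl_castLE, permIncl_castLE] at this
  exact congrArg (fun x : Fin N => (x : ℕ)) this

theorem exists_castLE {j : Fin N} (hj : (j : ℕ) < n) : ∃ i : Fin n, j = Fin.castLE hnN i :=
  ⟨⟨j, hj⟩, rfl⟩

theorem permIncl_swap (i j : Fin n) :
    permIncl hnN (Equiv.swap i j) = Equiv.swap (Fin.castLE hnN i) (Fin.castLE hnN j) := by
  ext k
  by_cases hk : (k : ℕ) < n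
  · obtain ⟨k, rfl⟩ := exists_castLE hnN hk
    rw [permIncl_castLE, (Fin.castLE_injective hnN).map_swap]
  · rw [permIncl_of_le hnN _ (not_lt.1 hk), Equiv.swap_apply_of_ne_of_ne]
    · rintro rfl
      exact hk i.isLt
    · rintro rfl
      exact hk j.isLt

theorem permIncl_mul_swap (u : Perm' n) (i j : Fin n) :
    permIncl hnN (u * Equiv.swap i j) =
      permIncl hnN u * Equiv.swap (Fin.castLE hnN i) (Fin.castLE hnN j) := by
  rw [permIncl_mul, permIncl_swap]

theorem permIncl_lt_iff (u : Perm' n) (i j : Fin n) :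
    permIncl hnN u (Fin.castLE hnN i) < permIncl hnN u (Fin.castLE hnN j) ↔ u i < u j := by
  rw [permIncl_castLE, permIncl_castLE]
  exact Iff.rfl

end Inclusion

section Leibniz

variable {n N : ℕ} (hnN : n ≤ N) {S : Perm' N → MvPolynomial (Fin N) ℤ}
  (hS : IsSchubertFamily N S)
include hS

theorem exists_schubertPairing_mul (w : Perm' n) (g : MvPolynomial (Fin N) ℤ) :
    ∃ A : Perm' n → ℤ, ∀ f, schubertPairing S (permIncl hnN w) (g * f) =
      ∑ v, A v * schubertPairing S (permIncl hnN v) f := by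
  induction w using descent_induction generalizing g with
  | base =>
    classical
    refine ⟨fun v => if v = 1 then constantCoeff g else 0, fun f => ?_⟩
    simp only [ite_mul, zero_mul, Finset.sum_ite_eq', Finset.mem_univ, if_true]
    rw [permIncl_one, schubertPairing_one hS, schubertPairing_one hS, map_mul]
  | step w p q hpq hw ih =>
    have hpq' : (Fin.castLE hnN q : ℕ) = Fin.castLE hnN p + 1 := hpq
    have hne := ne_of_adjacent hpq
    obtain ⟨g', hg⟩ := exists_isDivDiff (Fin.castLE hnN p) (Fin.castLE hnN q) g
    obtain ⟨A, hA⟩ := ih g'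
    obtain ⟨A', hA'⟩ := ih (rename (Equiv.swap (Fin.castLE hnN p) (Fin.castLE hnN q)) g)
    refine ⟨fun v => A v + if v q < v p then A' (v * Equiv.swap p q) else 0, fun f => ?_⟩
    obtain ⟨f', hf⟩ := exists_isDivDiff (Fin.castLE hnN p) (Fin.castLE hnN q) f
    rw [schubertPairing_descent hS hpq' (hg.mul hf) ((permIncl_lt_iff hnN w q p).2 hw),
      ← permIncl_mul_swap, map_add, hA, hA']
    simp only [add_mul, Finset.sum_add_distrib]
    congr 1
    rw [← Equiv.sum_comp (Equiv.mulRight (Equiv.swap p q))]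
    refine Finset.sum_congr rfl fun v _ => ?_
    rw [Equiv.coe_mulRight]
    split_ifs with hv
    · rw [schubertPairing_descent hS hpq' hf ((permIncl_lt_iff hnN v q p).2 hv),
        permIncl_mul_swap]
    · have hlt := lt_of_le_of_ne (not_lt.1 hv) (v.injective.ne hne)
      rw [schubertPairing_eq_zero hS hpq' (hf.rename_eq (ne_of_adjacent hpq')), mul_zero, zero_mul]
      rw [permIncl_lt_iff]
      simpa using hlt

theorem schubertPairing_mul (w : Perm' n) (g f : MvPolynomial (Fin N) ℤ) :
    schubertPairing S (permIncl hnN w) (g * f) =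
      ∑ v : Perm' n, schubertPairing S (permIncl hnN w) (g * S (permIncl hnN v)) *
        schubertPairing S (permIncl hnN v) f := by
  classical
  obtain ⟨A, hA⟩ := exists_schubertPairing_mul hnN hS w g
  rw [hA f]
  refine Finset.sum_congr rfl fun v _ => ?_
  rw [hA]
  simp only [schubertPairing_self hS, (permIncl_injective hnN).eq_iff]
  simp

theorem schubertPairing_w0 (v : Perm' n) (f : MvPolynomial (Fin N) ℤ) :
    schubertPairing S (permIncl hnN (w0 n)) (S (permIncl hnN (w0 n * v)) * f) =
      schubertPairing S (permIncl hnN v) f := by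
  induction v using descent_induction generalizing f with
  | base => rw [mul_one, schubertPairing_self_mul hS, permIncl_one, schubertPairing_one hS]
  | step v p q hpq hv ih =>
    have hpq' : (Fin.castLE hnN q : ℕ) = Fin.castLE hnN p + 1 := hpq
    obtain ⟨g, hg⟩ := exists_isDivDiff (Fin.castLE hnN p) (Fin.castLE hnN q) f
    rw [schubertPairing_descent hS hpq' hg ((permIncl_lt_iff hnN v q p).2 hv),
      ← permIncl_mul_swap, ← ih, eq_comm, ← sub_eq_zero, ← map_sub]
    refine schubertPairing_eq_zero hS hpq' (IsDivDiff.rename_sub (ne_of_adjacent hpq') ?_ hg) ?_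
    · rw [← mul_assoc, permIncl_mul_swap]
      refine hS.isDivDiff_mul_swap hpq' ?_
      rw [permIncl_lt_iff, w0_mul_lt_iff]
      exact hv
    · rw [permIncl_lt_iff, w0, Fin.revPerm_apply, Fin.revPerm_apply, Fin.rev_lt_rev, Fin.lt_def]
      omega

end Leibniz

section Transfer

variable {n N : ℕ} (hnN : n ≤ N)

theorem downCover_permIncl (w : Perm' n) (i j : Fin n) :
    DownCover (permIncl hnN w) (Fin.castLE hnN i) (Fin.castLE hnN j) ↔ DownCover w i j := by
  constructor
  · rintro ⟨h1, h2, h3⟩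
    refine ⟨h1, (permIncl_lt_iff hnN w j i).1 h2, fun m m1 m2 => ?_⟩
    rw [← permIncl_lt_iff hnN, ← permIncl_lt_iff hnN w m]
    exact h3 _ m1 m2
  · rintro ⟨h1, h2, h3⟩
    refine ⟨h1, (permIncl_lt_iff hnN w j i).2 h2, fun m m1 m2 => ?_⟩
    obtain ⟨m, rfl⟩ := exists_castLE hnN ((Fin.lt_def.1 m2).trans j.isLt)
    rw [permIncl_lt_iff hnN, permIncl_lt_iff hnN w m]
    exact h3 m m1 m2

theorem sum_downSteps_permIncl {K : ℕ} (hK : K ≤ n) (b : ℕ) (w : Perm' n)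
    (F : Fin N × Fin N → ℤ) :
    ∑ x ∈ downSteps K b (permIncl hnN w), F x =
      ∑ x ∈ downSteps K b w, F (Fin.castLE hnN x.1, Fin.castLE hnN x.2) := by
  symm
  refine Finset.sum_bij (fun x _ => (Fin.castLE hnN x.1, Fin.castLE hnN x.2)) ?_ ?_ ?_ ?_
  · intro x hx
    obtain ⟨h1, h2, h3, h4⟩ := mem_downSteps.1 hx
    refine mem_downSteps.2 ⟨h1, h2, (downCover_permIncl hnN w _ _).2 h3, ?_⟩
    dsimp only
    rw [permIncl_castLE]
    exact h4
  · rintro ⟨a, b⟩ _ ⟨a', b'⟩ _ h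
    simpa using h
  · rintro ⟨i, j⟩ hx
    obtain ⟨h1, h2, h3, h4⟩ := mem_downSteps.1 hx
    dsimp only at h1 h2 h3 h4
    obtain ⟨i, rfl⟩ := exists_castLE hnN (h1.trans_le hK)
    have hj : (j : ℕ) < n := by
      by_contra hj
      have hv := h3.2.1
      rw [permIncl_of_le hnN w (not_lt.1 hj), permIncl_castLE, Fin.lt_def] at hv
      exact hj (hv.trans (w i).isLt)
    obtain ⟨j, rfl⟩ := exists_castLE hnN hj
    rw [permIncl_castLE] at h4
    exact ⟨(i, j), mem_downSteps.2 ⟨h1, h2, (downCover_permIncl hnN w _ _).1 h3, h4⟩, rfl⟩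
  · intro x _
    rfl

theorem pieriSum_permIncl {K : ℕ} (hK : K ≤ n) (φ : Perm' N → ℤ) (B a : ℕ) (w : Perm' n) :
    pieriSum K φ B a (permIncl hnN w) = pieriSum K (fun u => φ (permIncl hnN u)) B a w := by
  induction B generalizing a w with
  | zero => cases a <;> rfl
  | succ B ih =>
    cases a with
    | zero => rw [pieriSum_zero, pieriSum_zero]
    | succ a =>
      rw [pieriSum_succ, pieriSum_succ, ih, sum_downSteps_permIncl hnN hK]
      congr 1
      refine Finset.sum_congr rfl fun x _ => ?_
      rw [← ih, permIncl_mul_swap]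

theorem pieriSum_eq_of_le {K : ℕ} (φ : Perm' n → ℤ) {B : ℕ} (hB : n ≤ B) (a : ℕ) (w : Perm' n) :
    pieriSum K φ B a w = pieriSum K φ n a w := by
  induction B, hB using Nat.le_induction generalizing a w with
  | base => rfl
  | succ B hB ih =>
    cases a with
    | zero => rw [pieriSum_zero, pieriSum_zero]
    | succ a =>
      rw [pieriSum_succ, ih, Finset.sum_eq_zero, add_zero]
      intro x hx
      have := (mem_downSteps.1 hx).2.2.2
      have := (w x.2).isLt
      omega

theorem blockSum_permIncl (α : ℕ → ℕ) (φ : Perm' N → ℤ) {K : ℕ} (hK : K ≤ n) (w : Perm' n) :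
    blockSum α φ K (permIncl hnN w) = blockSum α (fun u => φ (permIncl hnN u)) K w := by
  induction K generalizing w with
  | zero => rfl
  | succ K ih =>
    rw [blockSum, pieriSum_permIncl hnN hK, pieriSum_eq_of_le _ hnN, blockSum,
      funext fun w => ih (by omega) w]

end Transfer

section ChainList

variable {n : ℕ}

theorem isLabeledCover_iff {v w : Perm' n} {k b : ℕ} :
    IsLabeledCover v w k b ↔ ∃ x ∈ downSteps (k + 1) b w, v = w * Equiv.swap x.1 x.2 := by
  constructor
  · rintro ⟨i, j, hij, hv, hm, rfl, hik, hkj, rfl⟩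
    have hi : (v * Equiv.swap i j) i = v j := by
      rw [Equiv.Perm.mul_apply, Equiv.swap_apply_left]
    have hj : (v * Equiv.swap i j) j = v i := by
      rw [Equiv.Perm.mul_apply, Equiv.swap_apply_right]
    refine ⟨(i, j), mem_downSteps.2 ⟨Nat.lt_succ_of_le hik, hkj, ⟨hij, ?_, fun m h1 h2 => ?_⟩,
      congrArg Fin.val hj⟩, (mul_swap_mul_swap_self v i j).symm⟩
    · dsimp only
      rwa [hi, hj]
    · dsimp only
      rw [hi, hj, Equiv.Perm.mul_apply, Equiv.swap_apply_of_ne_of_ne h1.ne' h2.ne]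
      exact hm m h1 h2
  · rintro ⟨⟨i, j⟩, hx, rfl⟩
    obtain ⟨h1, h2, ⟨hij, hv, hm⟩, h4⟩ := mem_downSteps.1 hx
    dsimp only at *
    have hi : (w * Equiv.swap i j) i = w j := by
      rw [Equiv.Perm.mul_apply, Equiv.swap_apply_left]
    have hj : (w * Equiv.swap i j) j = w i := by
      rw [Equiv.Perm.mul_apply, Equiv.swap_apply_right]
    refine ⟨i, j, hij, by rwa [hi, hj], fun m m1 m2 => ?_, (mul_swap_mul_swap_self w i j).symm,
      Nat.le_of_lt_succ h1, h2, by rw [hi, h4]⟩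
    rw [hi, hj, Equiv.Perm.mul_apply, Equiv.swap_apply_of_ne_of_ne m1.ne' m2.ne]
    exact hm m m1 m2

theorem IsLabeledCover.label_lt {v w : Perm' n} {k b : ℕ} (h : IsLabeledCover v w k b) :
    k < n ∧ b < n := by
  obtain ⟨i, j, -, -, -, -, -, hk, rfl⟩ := h
  exact ⟨hk.trans j.isLt, (v i).isLt⟩

/-- `l` lists the steps of a labeled chain from `u` to `w`, last step first, each given by its
starting permutation and its label. -/
def IsStepList (u : Perm' n) : List (Perm' n × ℕ × ℕ) → Perm' n → Prop
  | [], w => w = u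
  | x :: l, w => IsLabeledCover x.1 w x.2.1 x.2.2 ∧ IsStepList u l x.1

theorem IsStepList.label_lt {u w : Perm' n} {l : List (Perm' n × ℕ × ℕ)} (h : IsStepList u l w) :
    ∀ x ∈ l, x.2.1 < n ∧ x.2.2 < n := by
  induction l generalizing w with
  | nil => simp
  | cons y l ih =>
    rw [List.forall_mem_cons]
    exact ⟨h.1.label_lt, ih h.2⟩

/-- The number of steps in the `k`-th block. -/
def blockCount (k : ℕ) (l : List (Perm' n × ℕ × ℕ)) : ℕ :=
  l.countP fun x => x.2.1 = k

theorem blockCount_cons (k : ℕ) (x : Perm' n × ℕ × ℕ) (l : List (Perm' n × ℕ × ℕ)) :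
    blockCount k (x :: l) = blockCount k l + if x.2.1 = k then 1 else 0 := by
  simp [blockCount, List.countP_cons]

/-- Step lists of increasing chains from `u` to `w` with labels less than `(K, B)`, with `α k`
steps in block `k < K` and `a` steps in block `K`. -/
structure IsIncreasingList (α : ℕ → ℕ) (u : Perm' n) (K B a : ℕ) (w : Perm' n)
    (l : List (Perm' n × ℕ × ℕ)) : Prop where
  isStepList : IsStepList u l w
  pairwise : l.Pairwise fun x y => lexLt y.2 x.2
  lt : ∀ x ∈ l, lexLt x.2 (K, B)
  count_lt : ∀ k < K, blockCount k l = α k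
  count : blockCount K l = a

variable {α : ℕ → ℕ} {u : Perm' n} {K B a : ℕ} {w : Perm' n} {l : List (Perm' n × ℕ × ℕ)}

theorem lexLt.trans {p q r : ℕ × ℕ} (h : lexLt p q) (h' : lexLt q r) : lexLt p r := by
  unfold lexLt at *
  omega

theorem isIncreasingList_succ :
    IsIncreasingList α u K (B + 1) a w l ↔ IsIncreasingList α u K B a w l ∨
      ∃ x ∈ downSteps (K + 1) B w, ∃ a' l', a = a' + 1 ∧
        l = (w * Equiv.swap x.1 x.2, K, B) :: l' ∧
        IsIncreasingList α u K B a' (w * Equiv.swap x.1 x.2) l' := by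
  constructor
  · intro h
    cases l with
    | nil => exact Or.inl ⟨h.1, h.2, by simp, h.4, h.5⟩
    | cons y l' =>
      obtain ⟨v, k, b⟩ := y
      have hp := List.pairwise_cons.1 h.pairwise
      have hlt := h.lt _ List.mem_cons_self
      by_cases hy : lexLt (k, b) (K, B)
      · refine Or.inl ⟨h.1, h.2, ?_, h.4, h.5⟩
        rw [List.forall_mem_cons]
        exact ⟨hy, fun x hx => (hp.1 x hx).trans hy⟩
      · obtain ⟨rfl, rfl⟩ : k = K ∧ b = B := by
          unfold lexLt at hlt hy
          dsimp only at hlt hy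
          omega
        obtain ⟨x, hx, hv⟩ := isLabeledCover_iff.1 h.isStepList.1
        dsimp only at hv hx
        subst hv
        refine Or.inr ⟨x, hx, blockCount k l', l', ?_, rfl, h.isStepList.2, hp.2, hp.1, ?_, rfl⟩
        · rw [← h.count, blockCount_cons, if_pos rfl]
        · intro k' hk'
          rw [← h.count_lt k' hk', blockCount_cons, if_neg hk'.ne', add_zero]
  · rintro (h | ⟨x, hx, a', l', rfl, rfl, h⟩)
    · refine ⟨h.1, h.2, fun x hx => (h.3 x hx).trans ?_, h.4, h.5⟩
      exact Or.inr ⟨rfl, Nat.lt_succ_self B⟩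
    · refine ⟨⟨isLabeledCover_iff.2 ⟨x, hx, rfl⟩, h.1⟩, List.pairwise_cons.2 ⟨h.3, h.2⟩, ?_, ?_, ?_⟩
      · rw [List.forall_mem_cons]
        refine ⟨Or.inr ⟨rfl, Nat.lt_succ_self B⟩, fun y hy => (h.3 y hy).trans ?_⟩
        exact Or.inr ⟨rfl, Nat.lt_succ_self B⟩
      · intro k hk
        rw [blockCount_cons, if_neg hk.ne', add_zero, h.count_lt k hk]
      · rw [blockCount_cons, if_pos rfl, h.count]

theorem isIncreasingList_block_zero :
    IsIncreasingList α u 0 0 a w l ↔ a = 0 ∧ l = [] ∧ w = u := by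
  constructor
  · intro h
    obtain rfl : l = [] := by
      rw [List.eq_nil_iff_forall_not_mem]
      intro x hx
      have := h.lt x hx
      unfold lexLt at this
      omega
    exact ⟨h.count.symm, rfl, h.isStepList⟩
  · rintro ⟨rfl, rfl, rfl⟩
    exact ⟨rfl, List.Pairwise.nil, by simp, by simp, rfl⟩

theorem isIncreasingList_block_succ :
    IsIncreasingList α u (K + 1) 0 a w l ↔ a = 0 ∧ IsIncreasingList α u K n (α K) w l := by
  constructor
  · intro h
    have hlt : ∀ x ∈ l, x.2.1 < K + 1 := fun x hx => by
      have := h.lt x hx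
      unfold lexLt at this
      dsimp only at this
      omega
    refine ⟨?_, h.1, h.2, fun x hx => ?_, fun k hk => h.4 k (by omega), h.4 K (by omega)⟩
    · rw [← h.count, blockCount, List.countP_eq_zero]
      intro x hx
      rw [decide_eq_true_eq]
      exact (hlt x hx).ne
    · have h1 := hlt x hx
      have h2 := (h.isStepList.label_lt x hx).2
      unfold lexLt
      dsimp only
      omega
  · rintro ⟨rfl, h⟩
    have hlt : ∀ x ∈ l, x.2.1 < K + 1 := fun x hx => by
      have := h.lt x hx
      unfold lexLt at this
      dsimp only at this
      omega
    refine ⟨h.1, h.2, fun x hx => Or.inl (hlt x hx), fun k hk => ?_, ?_⟩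
    · rcases Nat.lt_succ_iff_lt_or_eq.1 hk with hk | rfl
      · exact h.4 k hk
      · exact h.5
    · rw [blockCount, List.countP_eq_zero]
      intro x hx
      rw [decide_eq_true_eq]
      exact (hlt x hx).ne

theorem eq_of_mem_downSteps {x y : Fin n × Fin n} (hx : x ∈ downSteps K B w)
    (hy : y ∈ downSteps K B w) (h : w * Equiv.swap x.1 x.2 = w * Equiv.swap y.1 y.2) : x = y := by
  obtain ⟨x1, x2, -, x4⟩ := mem_downSteps.1 hx
  obtain ⟨y1, y2, -, y4⟩ := mem_downSteps.1 hy
  have h2 : x.2 = y.2 := w.injective (Fin.ext (x4.trans y4.symm))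
  have h1 := congrArg (fun f : Perm' n => f x.2) (mul_left_cancel h)
  simp only [Equiv.swap_apply_right] at h1
  rw [h2, Equiv.swap_apply_right] at h1
  exact Prod.ext h1 h2

open Classical in
theorem exists_finset_isIncreasingList_of_zero {φ : Perm' n → ℤ}
    (h₀ : ∀ w, ∃ F : Finset (List (Perm' n × ℕ × ℕ)),
      (∀ l, l ∈ F ↔ IsIncreasingList α u K 0 0 w l) ∧ (F.card : ℤ) = φ w)
    (hs : ∀ a w l, IsIncreasingList α u K 0 a w l → a = 0) (B a : ℕ) (w : Perm' n) :
    ∃ F : Finset (List (Perm' n × ℕ × ℕ)), (∀ l, l ∈ F ↔ IsIncreasingList α u K B a w l) ∧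
      (F.card : ℤ) = pieriSum (K + 1) φ B a w := by
  induction B generalizing a w with
  | zero =>
    cases a with
    | zero => exact h₀ w
    | succ a =>
      exact ⟨∅, fun l => iff_of_false (Finset.notMem_empty l) fun h =>
        Nat.succ_ne_zero a (hs _ _ _ h), rfl⟩
  | succ B ih =>
    choose F hF hc using ih
    cases a with
    | zero =>
      refine ⟨F 0 w, fun l => ?_, by rw [hc, pieriSum_zero, pieriSum_zero]⟩
      rw [hF, isIncreasingList_succ, or_iff_left]
      rintro ⟨x, -, a', l', h, -⟩
      exact Nat.succ_ne_zero a' h.symm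
    | succ a =>
      refine ⟨F (a + 1) w ∪ (downSteps (K + 1) B w).biUnion fun x =>
        (F a (w * Equiv.swap x.1 x.2)).image (List.cons (w * Equiv.swap x.1 x.2, K, B)),
        fun l => ?_, ?_⟩
      · rw [Finset.mem_union, hF, isIncreasingList_succ, Finset.mem_biUnion]
        refine or_congr_right (exists_congr fun x => and_congr_right fun _ => ?_)
        rw [Finset.mem_image]
        constructor
        · rintro ⟨l', hl', rfl⟩
          exact ⟨a, l', rfl, rfl, (hF _ _ _).1 hl'⟩
        · rintro ⟨a', l', ha, rfl, hl'⟩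
          obtain rfl := Nat.succ_injective ha
          exact ⟨l', (hF _ _ _).2 hl', rfl⟩
      · rw [Finset.card_union_of_disjoint, Finset.card_biUnion, pieriSum_succ]
        · push_cast
          rw [hc]
          congr 1
          refine Finset.sum_congr rfl fun x _ => ?_
          rw [Finset.card_image_of_injective _ (List.cons_injective), hc]
        · intro x hx y hy hxy
          refine Finset.disjoint_left.2 fun l h1 h2 => hxy ?_
          obtain ⟨l1, -, rfl⟩ := Finset.mem_image.1 h1
          obtain ⟨l2, -, h⟩ := Finset.mem_image.1 h2
          exact (eq_of_mem_downSteps hy hx (Prod.ext_iff.1 (List.cons.inj h).1).1).symm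
        · refine Finset.disjoint_left.2 fun l h1 h2 => ?_
          obtain ⟨x, -, h⟩ := Finset.mem_biUnion.1 h2
          obtain ⟨l', -, rfl⟩ := Finset.mem_image.1 h
          have := ((hF _ _ _).1 h1).lt _ List.mem_cons_self
          unfold lexLt at this
          dsimp only at this
          omega

open Classical in
theorem exists_finset_isIncreasingList (α : ℕ → ℕ) (u : Perm' n) (K B a : ℕ) (w : Perm' n) :
    ∃ F : Finset (List (Perm' n × ℕ × ℕ)), (∀ l, l ∈ F ↔ IsIncreasingList α u K B a w l) ∧
      (F.card : ℤ) =
        pieriSum (K + 1) (blockSum α (fun v => if v = u then 1 else 0) K) B a w := by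
  induction K generalizing B a w with
  | zero =>
    refine exists_finset_isIncreasingList_of_zero (fun w => ?_)
      (fun a w l h => (isIncreasingList_block_zero.1 h).1) B a w
    refine ⟨if w = u then {[]} else ∅, fun l => ?_, ?_⟩
    · rw [isIncreasingList_block_zero]
      split_ifs with h <;> simp [h]
    · rw [blockSum]
      split_ifs <;> rfl
  | succ K ih =>
    refine exists_finset_isIncreasingList_of_zero (fun w => ?_)
      (fun a w l h => (isIncreasingList_block_succ.1 h).1) B a w
    obtain ⟨F, hF, hc⟩ := ih n (α K) w
    refine ⟨F, fun l => ?_, hc⟩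
    rw [hF, isIncreasingList_block_succ, and_iff_right rfl]

end ChainList

section ChainCount

variable {n m : ℕ} {u w : Perm' n}

/-- The steps of a labeled chain, last step first. -/
def LabeledChain.toList (γ : LabeledChain n m u w) : List (Perm' n × ℕ × ℕ) :=
  List.ofFn fun i : Fin m => (γ.c i.rev.castSucc, γ.lab i.rev)

/-- The chain without its last step. -/
def LabeledChain.init (γ : LabeledChain n (m + 1) u w) :
    LabeledChain n m u (γ.c (Fin.last m).castSucc) where
  c i := γ.c i.castSucc
  lab i := γ.lab i.castSucc
  c_zero := γ.c_zero
  c_last := rfl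
  step i := γ.step i.castSucc

/-- The chain with one more step. -/
def LabeledChain.snoc {v : Perm' n} (γ : LabeledChain n m u v) (p : ℕ × ℕ)
    (h : IsLabeledCover v w p.1 p.2) : LabeledChain n (m + 1) u w where
  c := Fin.snoc γ.c w
  lab := Fin.snoc γ.lab p
  c_zero := by
    rw [← Fin.castSucc_zero, Fin.snoc_castSucc, γ.c_zero]
  c_last := Fin.snoc_last _ _
  step i := by
    induction i using Fin.lastCases with
    | last => simpa [γ.c_last] using h
    | cast i =>
      rw [Fin.succ_castSucc, Fin.snoc_castSucc, Fin.snoc_castSucc, Fin.snoc_castSucc]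
      exact γ.step i

theorem LabeledChain.toList_succ (γ : LabeledChain n (m + 1) u w) :
    γ.toList = (γ.c (Fin.last m).castSucc, γ.lab (Fin.last m)) :: γ.init.toList := by
  rw [toList, List.ofFn_succ, Fin.rev_zero]
  congr 1
  refine congrArg List.ofFn (funext fun i => ?_)
  rw [Fin.rev_succ]
  rfl

theorem LabeledChain.isStepList_toList (γ : LabeledChain n m u w) : IsStepList u γ.toList w := by
  induction m generalizing w with
  | zero => exact γ.c_last.symm.trans γ.c_zero
  | succ m ih =>
    rw [toList_succ]
    refine ⟨?_, ih _⟩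
    have h := γ.step (Fin.last m)
    rwa [Fin.succ_last, γ.c_last] at h

theorem IsStepList.exists_labeledChain {l : List (Perm' n × ℕ × ℕ)} (h : IsStepList u l w) :
    ∃ m, ∃ γ : LabeledChain n m u w, γ.toList = l := by
  induction l generalizing w with
  | nil =>
    obtain rfl : w = u := h
    exact ⟨0, ⟨fun _ => w, Fin.elim0, rfl, rfl, fun i => i.elim0⟩, rfl⟩
  | cons x l ih =>
    obtain ⟨m, γ, rfl⟩ := ih h.2
    refine ⟨m + 1, γ.snoc x.2 h.1, ?_⟩
    rw [LabeledChain.toList_succ]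
    refine congrArg₂ List.cons (Prod.ext ?_ ?_) ?_
    · exact (Fin.snoc_castSucc (α := fun _ => Perm' n) _ _ _).trans γ.c_last
    · exact Fin.snoc_last (α := fun _ => ℕ × ℕ) _ _
    · refine congrArg List.ofFn (funext fun i => Prod.ext ?_ ?_)
      · exact Fin.snoc_castSucc (α := fun _ => Perm' n) _ _ _
      · exact Fin.snoc_castSucc (α := fun _ => ℕ × ℕ) _ _ _

theorem LabeledChain.toList_injective {γ γ' : LabeledChain n m u w}
    (h : γ.toList = γ'.toList) : γ = γ' := by
  have h' := List.ofFn_injective h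
  have hi : ∀ i : Fin m, γ.c i.castSucc = γ'.c i.castSucc ∧ γ.lab i = γ'.lab i := fun i => by
    have := Prod.ext_iff.1 (congrFun h' i.rev)
    simpa only [Fin.rev_rev] using this
  obtain ⟨c, lab, h0, hl, hs⟩ := γ
  obtain ⟨c', lab', h0', hl', hs'⟩ := γ'
  obtain rfl : lab = lab' := funext fun i => (hi i).2
  obtain rfl : c = c' := by
    funext i
    induction i using Fin.lastCases with
    | last => exact hl.trans hl'.symm
    | cast i => exact (hi i).1
  rfl

theorem LabeledChain.pairwise_toList (γ : LabeledChain n m u w) :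
    γ.toList.Pairwise (fun x y => lexLt y.2 x.2) ↔ γ.Increasing := by
  rw [toList, List.pairwise_ofFn]
  constructor
  · intro h i j hij
    have := h (Fin.rev_lt_rev.2 hij)
    simpa only [Fin.rev_rev] using this
  · intro h i j hij
    exact h _ _ (Fin.rev_lt_rev.2 hij)

theorem LabeledChain.blockCount_toList (γ : LabeledChain n m u w) (k : Fin n) :
    blockCount k γ.toList = chainType γ k := by
  rw [blockCount, toList, List.countP_eq_length_filter, chainType, List.ofFn_eq_map,
    List.filter_map, List.length_map,
    ← Finset.card_map (Fin.revPerm : Equiv.Perm (Fin m)).toEmbedding]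
  rw [← List.toFinset_card_of_nodup ((List.nodup_finRange m).filter _)]
  congr 1
  ext i
  simp

/-- A composition with `n` parts as a sequence. -/
def extendZero (α : Fin n → ℕ) (k : ℕ) : ℕ :=
  if h : k < n then α ⟨k, h⟩ else 0

theorem LabeledChain.isIncreasingList_toList (γ : LabeledChain n m u w) (α : Fin n → ℕ) :
    IsIncreasingList (extendZero α) u n 0 0 w γ.toList ↔ γ.Increasing ∧ chainType γ = α := by
  have hl := fun x hx => (γ.isStepList_toList.label_lt x hx).1
  constructor
  · intro h
    refine ⟨γ.pairwise_toList.1 h.pairwise, funext fun k => ?_⟩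
    rw [← γ.blockCount_toList, h.count_lt k k.isLt, extendZero, dif_pos k.isLt]
  · rintro ⟨h, rfl⟩
    refine ⟨γ.isStepList_toList, γ.pairwise_toList.2 h, fun x hx => Or.inl (hl x hx),
      fun k hk => ?_, ?_⟩
    · rw [extendZero, dif_pos hk, ← γ.blockCount_toList]
    · rw [blockCount, List.countP_eq_zero]
      intro x hx
      rw [decide_eq_true_eq]
      exact (hl x hx).ne

open Classical in
theorem incChainCount_eq_blockSum (u w : Perm' n) (α : Fin n → ℕ) :
    (incChainCount n u w α : ℤ) =
      blockSum (extendZero α) (fun v => if v = u then 1 else 0) n w := by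
  obtain ⟨F, hF, hc⟩ := exists_finset_isIncreasingList (extendZero α) u n 0 0 w
  rw [pieriSum_zero] at hc
  rw [← hc, Nat.cast_inj, incChainCount, ← Nat.card_eq_finsetCard]
  refine Nat.card_eq_of_bijective (fun x => ⟨x.2.1.toList,
    (hF _).2 ((x.2.1.isIncreasingList_toList α).2 x.2.2)⟩) ⟨?_, ?_⟩
  · rintro ⟨m, γ, hγ⟩ ⟨m', γ', hγ'⟩ h
    have h := congrArg Subtype.val h
    dsimp only at h
    obtain rfl : m = m' := by
      have := congrArg List.length h
      simpa [LabeledChain.toList] using this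
    obtain rfl := LabeledChain.toList_injective h
    rfl
  · rintro ⟨l, hl⟩
    have h := (hF l).1 hl
    obtain ⟨m, γ, rfl⟩ := h.isStepList.exists_labeledChain
    exact ⟨⟨m, γ, (γ.isIncreasingList_toList α).1 h⟩, rfl⟩

end ChainCount

theorem incChainCount_eq_schubertPairing {n N : ℕ} (hnN : n ≤ N)
    {S : Perm' N → MvPolynomial (Fin N) ℤ} (hS : IsSchubertFamily N S) (α : Fin n → ℕ)
    (x y : Perm' n) :
    (incChainCount n x y α : ℤ) =
      schubertPairing S (permIncl hnN y) (S (permIncl hnN x) *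
        ∏ k ∈ Finset.range n, completeH N (k + 1) (extendZero α k)) := by
  classical
  rw [incChainCount_eq_blockSum, ← blockSum_schubertPairing hS _ hnN,
    blockSum_permIncl hnN _ _ le_rfl]
  congr 1
  funext v
  rw [schubertPairing_self hS]
  exact if_congr (eq_comm.trans (permIncl_injective hnN).eq_iff.symm) rfl rfl

/-- For `u ≤ w` in Bruhat order and `α` a composition of
`ℓ(w) - ℓ(u)`, we have `I_α(u,w) = ∑_v c^w_{u,v} · I_α(w₀v, w₀)`, where the
Littlewood–Richardson coefficients are defined by the expansion of products of
(stable) Schubert polynomials, computed in a symmetric group `Σ_N ⊇ Σ_n`. -/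
theorem chain_count_eq_sum_LR_chain_counts (n N : ℕ) (hnN : n ≤ N)
    (SN : Perm' N → MvPolynomial (Fin N) ℤ) (hSN : IsSchubertFamily N SN)
    (u w : Perm' n) (huw : BruhatLE u w)
    (α : Fin n → ℕ) (hsum : ∑ i, α i = invLength w - invLength u)
    (c : Perm' n → Perm' N → ℤ)
    (hc : ∀ v : Perm' n,
      SN (permIncl hnN u) * SN (permIncl hnN v) = ∑ w' : Perm' N, c v w' • SN w') :
    (incChainCount n u w α : ℤ) =
      ∑ v : Perm' n, c v (permIncl hnN w) * (incChainCount n (w0 n * v) (w0 n) α : ℤ) := by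
  have hI : ∀ x y : Perm' n, (incChainCount n x y α : ℤ) =
      schubertPairing SN (permIncl hnN y) (SN (permIncl hnN x) *
        ∏ k ∈ Finset.range n, completeH N (k + 1) (extendZero α k)) :=
    incChainCount_eq_schubertPairing hnN hSN α
  have hcw : ∀ v : Perm' n, c v (permIncl hnN w) = schubertPairing SN (permIncl hnN w)
      (SN (permIncl hnN u) * SN (permIncl hnN v)) := fun v => by
    classical
    rw [hc v, map_sum, Finset.sum_eq_single (permIncl hnN w)]
    · rw [map_smul, schubertPairing_self hSN, if_pos rfl, smul_eq_mul, mul_one]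
    · intro x _ hx
      rw [map_smul, schubertPairing_self hSN, if_neg hx, smul_zero]
    · exact fun h => absurd (Finset.mem_univ _) h
  rw [hI, schubertPairing_mul hnN hSN]
  refine Finset.sum_congr rfl fun v _ => ?_
  rw [hcw, hI, schubertPairing_w0 hnN hSN]
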